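/- arXiv:1407.7662 — 4 statements merged into one kernel-verified Lean document; each statement's English description precedes it below -/
import Mathlib

section
/- For each n, let (d_n⁺(v),d_n⁻(v))_{v∈V_n} be a (possibly random) bi-degree sequence with equal totals m_n, and conditionally on it let Ê_n be the edge multiplicities of the directed configuration model multigraph obtained from a uniformly random stub pairing. Assume m_n → ∞ in probability. Then for all k,l∈ℕ and α,β∈{+,−}, the conditional variance of Φ_n^{α,β}(k,l) given the bi-degree sequence converges to 0 in probability, i.e. E[Φ_n^{α,β}(k,l)² | (d_n⁺,d_n⁻)] − E[Φ_n^{α,β}(k,l) | (d_n⁺,d_n⁻)]² → 0 in probability as n→∞. -/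
open Finset MeasureTheory ProbabilityTheory Filter

/-! ### The directed configuration model -/

/-- Outbound stubs of a bi-degree sequence. -/
abbrev OutStub {V : Type*} (dp : V → ℕ) := (v : V) × Fin (dp v)

/-- Inbound stubs of a bi-degree sequence. -/
abbrev InStub {V : Type*} (dm : V → ℕ) := (v : V) × Fin (dm v)

instance pairingMeasurableSpace {V : Type*} (dp dm : V → ℕ) :
    MeasurableSpace (OutStub dp ≃ InStub dm) := ⊤

/-- `Ê(v,w)`: the number of outbound stubs of `v` paired with inbound stubs of `w`
under the pairing `σ`. -/
def pairingMult {V : Type*} [Fintype V] [DecidableEq V] (dp dm : V → ℕ)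
    (σ : OutStub dp ≃ InStub dm) (e : V × V) : ℕ :=
  (Finset.univ.filter (fun i : Fin (dp e.1) => (σ ⟨e.1, i⟩).1 = e.2)).card

/-- The uniform probability measure on the set of pairings (bijections between outbound
and inbound stubs). -/
noncomputable def uniformPairing {V : Type*} [Fintype V] [DecidableEq V] (dp dm : V → ℕ) :
    Measure (OutStub dp ≃ InStub dm) :=
  (Fintype.card (OutStub dp ≃ InStub dm) : ENNReal)⁻¹ • Measure.count

/-- Bi-degree of type `α` (`true` = `+`, `false` = `−`). -/
def bideg {V : Type*} (dp dm : V → ℕ) (α : Bool) (v : V) : ℕ := if α then dp v else dm v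

/-- `I_e^{α,β}(k,l) = 1{d^α(π_*e) = k}·1{d^β(π*e) = l}` (as a real number). -/
def indCM {V : Type*} (dp dm : V → ℕ) (α β : Bool) (k l : ℕ) (e : V × V) : ℝ :=
  if bideg dp dm α e.1 = k ∧ bideg dp dm β e.2 = l then 1 else 0

/-- `Φ^{α,β}(k,l) = Σ_{e∈V×V} I_e^{α,β}(k,l)·Ê(e)/m`, the probability that a uniformly
sampled edge of the realized multigraph has `α`-degree `k` at its source and `β`-degree
`l` at its target. -/
noncomputable def phiCM {V : Type*} [Fintype V] (dp dm : V → ℕ) (α β : Bool) (k l : ℕ)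
    (Eh : V × V → ℕ) : ℝ :=
  ∑ e : V × V, indCM dp dm α β k l e * (Eh e : ℝ) / (∑ v, dp v : ℝ)

section Helpers

/-- Finite-sum core: variance bound for the number of stubs in `S` matched into `T`. -/
theorem cm_equiv_core {A B : Type*} [Fintype A] [DecidableEq A] [Fintype B] [DecidableEq B]
    (s : A → ℝ) (hs : ∀ a, s a = 0 ∨ s a = 1) (t : B → ℝ) (ht : ∀ b, t b = 0 ∨ t b = 1)
    (e0 : A ≃ B) (hA : 0 < Fintype.card A) :
    let c : ℝ := (Fintype.card (A ≃ B) : ℝ)⁻¹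
    c * ∑ σ : A ≃ B, (∑ a, s a * t (σ a)) ^ 2 - (c * ∑ σ : A ≃ B, ∑ a, s a * t (σ a)) ^ 2
      ≤ (Fintype.card A : ℝ) := by
  intro c
  have hN : (0 : ℝ) < Fintype.card (A ≃ B) := by
    have : Nonempty (A ≃ B) := ⟨e0⟩
    exact_mod_cast Fintype.card_pos
  have hc : 0 < c := inv_pos.mpr hN
  have hcN : c * Fintype.card (A ≃ B) = 1 := inv_mul_cancel₀ hN.ne'
  have htt : ∀ b, t b * t b = t b := fun b => by rcases ht b with h | h <;> simp [h]
  have ht0 : ∀ b, 0 ≤ t b := fun b => by rcases ht b with h | h <;> simp [h]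
  have ht1 : ∀ b, t b ≤ 1 := fun b => by rcases ht b with h | h <;> simp [h]
  have hs0 : ∀ b, 0 ≤ s b := fun b => by rcases hs b with h | h <;> simp [h]
  have hs1 : ∀ b, s b ≤ 1 := fun b => by rcases hs b with h | h <;> simp [h]
  set m : ℝ := (Fintype.card A : ℝ) with hm
  have hm0 : 0 < m := by rw [hm]; exact_mod_cast hA
  set T : ℝ := ∑ b, t b with hT
  have hsum : ∀ σ : A ≃ B, ∑ a, t (σ a) = T := fun σ => Equiv.sum_comp σ t
  -- reindexing
  have reidx : ∀ (τ : Equiv.Perm A) (f : (A ≃ B) → ℝ), ∑ σ : A ≃ B, f (τ.trans σ) = ∑ σ, f σ := by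
    intro τ f
    refine Fintype.sum_equiv (Equiv.equivCongr τ.symm (Equiv.refl B)) _ _ ?_
    intro σ
    congr 1
  let E1 : A → ℝ := fun a => c * ∑ σ : A ≃ B, t (σ a)
  let E2 : A → A → ℝ := fun a b => c * ∑ σ : A ≃ B, t (σ a) * t (σ b)
  have hE1 : ∀ a b, E1 a = E1 b := by
    intro a b
    have := reidx (Equiv.swap a b) (fun σ => t (σ a))
    simp only [Equiv.trans_apply, Equiv.swap_apply_left] at this
    simp only [E1, this]
  have hE2 : ∀ j a b, a ≠ j → b ≠ j → E2 a j = E2 b j := by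
    intro j a b ha hb
    have := reidx (Equiv.swap a b) (fun σ => t (σ a) * t (σ j))
    simp only [Equiv.trans_apply, Equiv.swap_apply_left,
      Equiv.swap_apply_of_ne_of_ne ha.symm hb.symm] at this
    simp only [E2, this]
  have hE1m : ∀ a, m * E1 a = T := by
    intro a
    have h1 : ∑ b, E1 b = m * E1 a := by
      rw [Finset.sum_congr rfl (fun b _ => hE1 b a)]; simp [hm]
    rw [← h1]
    simp only [E1]
    rw [← Finset.mul_sum, Finset.sum_comm, Finset.sum_congr rfl (fun σ _ => hsum σ)]
    simp only [Finset.sum_const, Finset.card_univ, nsmul_eq_mul]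
    rw [← mul_assoc, hcN, one_mul]
  have hE2d : ∀ a, E2 a a = E1 a := by
    intro a; simp only [E1, E2, htt]
  have hE2s : ∀ j, ∑ a, E2 a j = T * E1 j := by
    intro j
    simp only [E1, E2]
    rw [← Finset.mul_sum, Finset.sum_comm]
    simp_rw [← Finset.sum_mul, hsum]
    rw [← Finset.mul_sum]; ring
  have hE10 : ∀ a, 0 ≤ E1 a := fun a =>
    mul_nonneg hc.le (Finset.sum_nonneg fun σ _ => ht0 _)
  have hE11 : ∀ a, E1 a ≤ 1 := fun a => by
    rw [← hcN]
    refine mul_le_mul_of_nonneg_left ?_ hc.le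
    calc ∑ σ : A ≃ B, t (σ a) ≤ ∑ σ : A ≃ B, (1 : ℝ) := Finset.sum_le_sum fun σ _ => ht1 _
      _ = _ := by simp
  have hcov : ∀ a j, a ≠ j → E2 a j ≤ E1 a * E1 j := by
    intro a j haj
    have h1 : ∑ x, E2 x j = E1 j + (m - 1) * E2 a j := by
      rw [← Finset.add_sum_erase _ _ (Finset.mem_univ j), hE2d]
      congr 1
      rw [Finset.sum_congr rfl (fun b hb => hE2 j b a (Finset.ne_of_mem_erase hb) haj)]
      simp only [Finset.sum_const, nsmul_eq_mul, Finset.card_erase_of_mem (Finset.mem_univ j),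
        Finset.card_univ]
      rw [Nat.cast_sub hA]; simp [hm]
    have h2 := hE2s j
    have h3 := hE1m j
    have hm1 : 0 < m - 1 := by
      have : 1 < Fintype.card A := Fintype.one_lt_card_iff.mpr ⟨a, j, haj⟩
      have : (1 : ℝ) < m := by rw [hm]; exact_mod_cast this
      linarith
    rw [hE1 a j]
    have h4 : (m - 1) * E2 a j = (m * E1 j - 1) * E1 j := by
      rw [h3]; linarith
    have h5 : (m - 1) * E2 a j ≤ (m - 1) * (E1 j * E1 j) := by
      rw [h4]; nlinarith [hE10 j, hE11 j, mul_nonneg (hE10 j) (sub_nonneg.2 (hE11 j))]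
    exact le_of_mul_le_mul_left h5 hm1
  have e1 : c * ∑ σ : A ≃ B, ∑ a, s a * t (σ a) = ∑ a, s a * E1 a := by
    rw [Finset.sum_comm, Finset.mul_sum]
    refine Finset.sum_congr rfl fun a _ => ?_
    simp only [E1]; rw [← Finset.mul_sum]; ring
  have e2 : c * ∑ σ : A ≃ B, (∑ a, s a * t (σ a)) ^ 2 = ∑ a, ∑ b, s a * s b * E2 a b := by
    simp_rw [pow_two, Finset.sum_mul_sum]
    rw [Finset.sum_comm, Finset.mul_sum]
    refine Finset.sum_congr rfl fun a _ => ?_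
    rw [Finset.sum_comm, Finset.mul_sum]
    refine Finset.sum_congr rfl fun b _ => ?_
    simp only [E2]
    rw [Finset.mul_sum, Finset.mul_sum, Finset.mul_sum]
    refine Finset.sum_congr rfl fun σ _ => ?_
    ring
  rw [e1, e2, pow_two, Finset.sum_mul_sum, ← Finset.sum_sub_distrib]
  calc ∑ a, (∑ b, s a * s b * E2 a b - ∑ b, s a * E1 a * (s b * E1 b))
      ≤ ∑ a : A, (1 : ℝ) := Finset.sum_le_sum fun a _ => ?_
    _ = m := by simp [hm]
  rw [← Finset.sum_sub_distrib]
  calc ∑ b, (s a * s b * E2 a b - s a * E1 a * (s b * E1 b))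
      ≤ ∑ b, (if b = a then (1 : ℝ) else 0) := Finset.sum_le_sum fun b _ => ?_
    _ = 1 := by simp
  have hss : 0 ≤ s a * s b := mul_nonneg (hs0 a) (hs0 b)
  have hss1 : s a * s b ≤ 1 := mul_le_one₀ (hs1 a) (hs0 b) (hs1 b)
  split_ifs with h
  · subst h
    rw [hE2d]
    have := hE10 b
    have h6 : s b * s b * E1 b ≤ 1 := mul_le_one₀ hss1 this (hE11 b)
    have h7 : 0 ≤ s b * E1 b * (s b * E1 b) := mul_self_nonneg _
    linarith
  · have := hcov a b (Ne.symm h)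
    have := mul_le_mul_of_nonneg_left this hss
    nlinarith

theorem cm_phi_pairing {V : Type*} [Fintype V] [DecidableEq V] (dp dm : V → ℕ) (α β : Bool)
    (k l : ℕ) (σ : OutStub dp ≃ InStub dm) :
    phiCM dp dm α β k l (pairingMult dp dm σ) =
      (∑ x : OutStub dp, (if bideg dp dm α x.1 = k then (1 : ℝ) else 0) *
        (if bideg dp dm β (σ x).1 = l then (1 : ℝ) else 0)) / (∑ v, dp v : ℝ) := by
  unfold phiCM
  rw [← Finset.sum_div]
  congr 1
  rw [Fintype.sum_prod_type, Fintype.sum_sigma]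
  refine Finset.sum_congr rfl fun v _ => ?_
  simp only [pairingMult, indCM, Finset.card_filter, Nat.cast_sum, Finset.mul_sum]
  change ∑ y : V, ∑ i : Fin (dp v),
    (if bideg dp dm α v = k ∧ bideg dp dm β y = l then (1 : ℝ) else 0) *
      ((if (σ ⟨v, i⟩).1 = y then 1 else 0 : ℕ) : ℝ) = _
  rw [Finset.sum_comm]
  refine Finset.sum_congr rfl fun i _ => ?_
  simp only [Nat.cast_ite, Nat.cast_one, Nat.cast_zero, mul_ite, mul_one, mul_zero]
  rw [Finset.sum_ite_eq]
  simp only [Finset.mem_univ, if_true]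
  split_ifs <;> simp_all

theorem cm_phi_bound {V : Type*} [Fintype V] [DecidableEq V] (dp dm : V → ℕ) (α β : Bool)
    (k l : ℕ) (σ : OutStub dp ≃ InStub dm) :
    |phiCM dp dm α β k l (pairingMult dp dm σ)| ≤ 1 := by
  rw [cm_phi_pairing, abs_of_nonneg]
  · refine div_le_one_of_le₀ ?_ (by positivity)
    calc _ ≤ ∑ x : OutStub dp, (1 : ℝ) := Finset.sum_le_sum fun x _ => by split_ifs <;> simp
      _ = _ := by simp
  · refine div_nonneg (Finset.sum_nonneg fun x _ => by split_ifs <;> simp) (by positivity)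

theorem cm_integral {V : Type*} [Fintype V] [DecidableEq V] (dp dm : V → ℕ)
    (f : (OutStub dp ≃ InStub dm) → ℝ) :
    ∫ σ, f σ ∂uniformPairing dp dm =
      (Fintype.card (OutStub dp ≃ InStub dm) : ℝ)⁻¹ * ∑ σ, f σ := by
  have : MeasurableSingletonClass (OutStub dp ≃ InStub dm) := ⟨fun _ => trivial⟩
  unfold uniformPairing
  rw [integral_smul_measure, integral_count]
  simp

theorem cm_var_bound {V : Type*} [Fintype V] [DecidableEq V] (dp dm : V → ℕ) (α β : Bool)
    (k l : ℕ) (htot : ∑ v, dp v = ∑ v, dm v) (hpos : 0 < ∑ v, dp v) :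
    |(∫ σ, phiCM dp dm α β k l (pairingMult dp dm σ) ^ 2 ∂uniformPairing dp dm) -
      (∫ σ, phiCM dp dm α β k l (pairingMult dp dm σ) ∂uniformPairing dp dm) ^ 2|
      ≤ 1 / (∑ v, dp v : ℕ) := by
  have hcard : Fintype.card (OutStub dp) = ∑ v, dp v := by simp
  obtain ⟨e0⟩ : Nonempty (OutStub dp ≃ InStub dm) := by
    rw [← Fintype.card_eq]; simpa using htot
  have core := cm_equiv_core (A := OutStub dp) (B := InStub dm)
    (fun x => if bideg dp dm α x.1 = k then (1 : ℝ) else 0)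
    (fun x => by split_ifs <;> simp)
    (fun x => if bideg dp dm β x.1 = l then (1 : ℝ) else 0)
    (fun x => by split_ifs <;> simp) e0 (by rw [hcard]; exact hpos)
  rw [hcard] at core
  have hN : (0 : ℝ) < Fintype.card (OutStub dp ≃ InStub dm) := by
    have : Nonempty (OutStub dp ≃ InStub dm) := ⟨e0⟩
    exact_mod_cast Fintype.card_pos
  rw [cm_integral, cm_integral]
  have hm : (0 : ℝ) < ((∑ v, dp v : ℕ) : ℝ) := by exact_mod_cast hpos
  rw [abs_of_nonneg]
  · simp_rw [cm_phi_pairing]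
    rw [← Nat.cast_sum]
    simp only at core
    set M : ℝ := ((∑ v, dp v : ℕ) : ℝ) with hM
    simp_rw [div_pow]
    rw [← Finset.sum_div, ← Finset.sum_div, le_div_iff₀ hm]
    rw [← mul_div_assoc, ← mul_div_assoc, div_pow, ← sub_div, pow_two M,
      div_mul_eq_mul_div, div_le_one (by positivity)]
    exact mul_le_mul_of_nonneg_right core hm.le
  · have := sq_sum_le_card_mul_sum_sq (s := (Finset.univ : Finset (OutStub dp ≃ InStub dm)))
      (f := fun σ => phiCM dp dm α β k l (pairingMult dp dm σ))
    rw [Finset.card_univ] at this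
    rw [mul_pow, sub_nonneg]
    calc _ ≤ ((Fintype.card (OutStub dp ≃ InStub dm) : ℝ)⁻¹) ^ 2 *
          ((Fintype.card (OutStub dp ≃ InStub dm) : ℝ) *
            ∑ σ : OutStub dp ≃ InStub dm, phiCM dp dm α β k l (pairingMult dp dm σ) ^ 2) :=
          mul_le_mul_of_nonneg_left this (by positivity)
      _ = _ := by field_simp

/-- Disintegration for bounded functions of the degrees and the multiplicities. -/
theorem cm_condExp_bdd {Ω : Type*} [mΩ : MeasurableSpace Ω] (μ : Measure Ω)
    [IsProbabilityMeasure μ] (n : ℕ)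
    (dp dm : Ω → (Fin n → ℕ)) (hdp : Measurable dp) (hdm : Measurable dm)
    (Eh : Ω → (Fin n × Fin n → ℕ)) (hEh : Measurable Eh)
    (hCM : ∀ (g : (Fin n × Fin n → ℕ) → ℝ), (∃ C, ∀ x, |g x| ≤ C) →
      μ[(fun ω => g (Eh ω)) |
          MeasurableSpace.comap (fun ω => (dp ω, dm ω)) inferInstance] =ᵐ[μ]
        fun ω => ∫ σ, g (pairingMult (dp ω) (dm ω) σ) ∂ uniformPairing (dp ω) (dm ω))
    (F : (Fin n → ℕ) × (Fin n → ℕ) → (Fin n × Fin n → ℕ) → ℝ) (C : ℝ)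
    (hF : ∀ d x, |F d x| ≤ C) :
    μ[(fun ω => F (dp ω, dm ω) (Eh ω)) |
        MeasurableSpace.comap (fun ω => (dp ω, dm ω)) inferInstance] =ᵐ[μ]
      fun ω => ∫ σ, F (dp ω, dm ω) (pairingMult (dp ω) (dm ω) σ)
        ∂ uniformPairing (dp ω) (dm ω) := by
  have hD : Measurable (fun ω => (dp ω, dm ω)) := hdp.prodMk hdm
  have hle : MeasurableSpace.comap (fun ω => (dp ω, dm ω)) inferInstance ≤ mΩ := hD.comap_le
  have hmF : Measurable (fun p : ((Fin n → ℕ) × (Fin n → ℕ)) × (Fin n × Fin n → ℕ) =>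
    F p.1 p.2) := measurable_of_countable _
  have hint : Integrable (fun ω => F (dp ω, dm ω) (Eh ω)) μ :=
    Integrable.of_bound (hmF.comp (hD.prodMk hEh)).aestronglyMeasurable C
      (Eventually.of_forall fun ω => hF _ _)
  have key : ∀ d : (Fin n → ℕ) × (Fin n → ℕ), ∀ᵐ ω ∂μ, (dp ω, dm ω) = d →
      (μ[(fun ω => F (dp ω, dm ω) (Eh ω)) |
        MeasurableSpace.comap (fun ω => (dp ω, dm ω)) inferInstance]) ω =
      ∫ σ, F d (pairingMult (dp ω) (dm ω) σ) ∂ uniformPairing (dp ω) (dm ω) := by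
    intro d
    set S : Set Ω := (fun ω => (dp ω, dm ω)) ⁻¹' {d} with hS
    have hSm : MeasurableSet[MeasurableSpace.comap (fun ω => (dp ω, dm ω)) inferInstance] S :=
      ⟨{d}, measurableSet_singleton d, rfl⟩
    have hint' : Integrable (fun ω => F d (Eh ω)) μ :=
      Integrable.of_bound
        ((measurable_of_countable (F d)).comp hEh).aestronglyMeasurable C
        (Eventually.of_forall fun ω => hF _ _)
    have h1 := condExp_indicator hint hSm
    have h2 := condExp_indicator hint' hSm
    have h3 : S.indicator (fun ω => F (dp ω, dm ω) (Eh ω)) = S.indicator (fun ω => F d (Eh ω)) := by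
      ext ω
      by_cases h : ω ∈ S
      · have h' : (dp ω, dm ω) = d := h
        simp [h, h']
      · simp [h]
    rw [h3] at h1
    filter_upwards [h1, h2, hCM (F d) ⟨C, hF d⟩] with ω a b c hω
    have hω' : ω ∈ S := hω
    rw [a, Set.indicator_of_mem hω', Set.indicator_of_mem hω', c] at b
    exact b
  filter_upwards [ae_all_iff.2 key] with ω h
  exact h _ rfl

/-- Almost surely, the multiplicities come from a pairing. -/
theorem cm_ae_range {Ω : Type*} [mΩ : MeasurableSpace Ω] (μ : Measure Ω)
    [IsProbabilityMeasure μ] (n : ℕ)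
    (dp dm : Ω → (Fin n → ℕ)) (hdp : Measurable dp) (hdm : Measurable dm)
    (Eh : Ω → (Fin n × Fin n → ℕ)) (hEh : Measurable Eh)
    (hCM : ∀ (g : (Fin n × Fin n → ℕ) → ℝ), (∃ C, ∀ x, |g x| ≤ C) →
      μ[(fun ω => g (Eh ω)) |
          MeasurableSpace.comap (fun ω => (dp ω, dm ω)) inferInstance] =ᵐ[μ]
        fun ω => ∫ σ, g (pairingMult (dp ω) (dm ω) σ) ∂ uniformPairing (dp ω) (dm ω)) :
    ∀ᵐ ω ∂μ, ∃ σ, Eh ω = pairingMult (dp ω) (dm ω) σ := by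
  classical
  let F : (Fin n → ℕ) × (Fin n → ℕ) → (Fin n × Fin n → ℕ) → ℝ := fun d x =>
    if ∃ σ, x = pairingMult d.1 d.2 σ then 0 else 1
  have hF0 : ∀ d x, 0 ≤ F d x := fun d x => by simp only [F]; split_ifs <;> simp
  have hF : ∀ d x, |F d x| ≤ 1 := fun d x => by simp only [F]; split_ifs <;> simp
  have h := cm_condExp_bdd μ n dp dm hdp hdm Eh hEh hCM F 1 hF
  have hD : Measurable (fun ω => (dp ω, dm ω)) := hdp.prodMk hdm
  have hle : MeasurableSpace.comap (fun ω => (dp ω, dm ω)) inferInstance ≤ mΩ := hD.comap_le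
  have hmF : Measurable (fun p : ((Fin n → ℕ) × (Fin n → ℕ)) × (Fin n × Fin n → ℕ) =>
    F p.1 p.2) := measurable_of_countable _
  have hint : Integrable (fun ω => F (dp ω, dm ω) (Eh ω)) μ :=
    Integrable.of_bound (hmF.comp (hD.prodMk hEh)).aestronglyMeasurable 1
      (Eventually.of_forall fun ω => hF _ _)
  have h0 : (fun ω => ∫ σ, F (dp ω, dm ω) (pairingMult (dp ω) (dm ω) σ)
        ∂ uniformPairing (dp ω) (dm ω)) = fun _ => 0 := by
    funext ω
    have : ∀ σ, F (dp ω, dm ω) (pairingMult (dp ω) (dm ω) σ) = 0 := fun σ => if_pos ⟨σ, rfl⟩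
    simp [this]
  rw [h0] at h
  have hI : ∫ ω, F (dp ω, dm ω) (Eh ω) ∂μ = 0 := by
    rw [← integral_condExp hle, integral_congr_ae h]; simp
  have := (integral_eq_zero_iff_of_nonneg (fun ω => hF0 _ _) hint).1 hI
  filter_upwards [this] with ω hω
  by_contra hcon
  have h1 : F (dp ω, dm ω) (Eh ω) = 1 := if_neg hcon
  simp only [Pi.zero_apply] at hω
  rw [h1] at hω
  exact one_ne_zero hω

/-- Disintegration for functions bounded on realizable multiplicities. -/
theorem cm_condExp {Ω : Type*} [mΩ : MeasurableSpace Ω] (μ : Measure Ω)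
    [IsProbabilityMeasure μ] (n : ℕ)
    (dp dm : Ω → (Fin n → ℕ)) (hdp : Measurable dp) (hdm : Measurable dm)
    (Eh : Ω → (Fin n × Fin n → ℕ)) (hEh : Measurable Eh)
    (hCM : ∀ (g : (Fin n × Fin n → ℕ) → ℝ), (∃ C, ∀ x, |g x| ≤ C) →
      μ[(fun ω => g (Eh ω)) |
          MeasurableSpace.comap (fun ω => (dp ω, dm ω)) inferInstance] =ᵐ[μ]
        fun ω => ∫ σ, g (pairingMult (dp ω) (dm ω) σ) ∂ uniformPairing (dp ω) (dm ω))
    (F : (Fin n → ℕ) × (Fin n → ℕ) → (Fin n × Fin n → ℕ) → ℝ)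
    (hF : ∀ d σ, |F d (pairingMult d.1 d.2 σ)| ≤ 1) :
    μ[(fun ω => F (dp ω, dm ω) (Eh ω)) |
        MeasurableSpace.comap (fun ω => (dp ω, dm ω)) inferInstance] =ᵐ[μ]
      fun ω => ∫ σ, F (dp ω, dm ω) (pairingMult (dp ω) (dm ω) σ)
        ∂ uniformPairing (dp ω) (dm ω) := by
  classical
  let G : (Fin n → ℕ) × (Fin n → ℕ) → (Fin n × Fin n → ℕ) → ℝ := fun d x =>
    if |F d x| ≤ 1 then F d x else 0
  have hG : ∀ d x, |G d x| ≤ 1 := fun d x => by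
    simp only [G]
    split_ifs with h
    · exact h
    · simp
  have hGF : ∀ d σ, G d (pairingMult d.1 d.2 σ) = F d (pairingMult d.1 d.2 σ) :=
    fun d σ => if_pos (hF d σ)
  have h := cm_condExp_bdd μ n dp dm hdp hdm Eh hEh hCM G 1 hG
  have hae : (fun ω => F (dp ω, dm ω) (Eh ω)) =ᵐ[μ] fun ω => G (dp ω, dm ω) (Eh ω) := by
    filter_upwards [cm_ae_range μ n dp dm hdp hdm Eh hEh hCM] with ω ⟨σ, hσ⟩
    rw [hσ]
    exact (hGF (dp ω, dm ω) σ).symm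
  refine (condExp_congr_ae hae).trans (h.trans (Eventually.of_forall fun ω => ?_))
  exact integral_congr_ae (Eventually.of_forall fun σ => hGF (dp ω, dm ω) σ)

end Helpers

/-- For random bi-degree sequences with equal totals `m_n → ∞` in
probability, and `Ê_n` distributed, conditionally on the bi-degrees, as the directed
configuration model from a uniformly random stub pairing, the conditional variance of
`Φ_n^{α,β}(k,l)` given the bi-degree sequence converges to `0` in probability. -/
theorem cm_conditional_variance_vanishes
    {Ω : Type*} [MeasurableSpace Ω] (μ : Measure Ω) [IsProbabilityMeasure μ]
    (dpn dmn : (n : ℕ) → Ω → (Fin n → ℕ))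
    (hdp : ∀ n, Measurable (dpn n)) (hdm : ∀ n, Measurable (dmn n))
    (htot : ∀ n ω, ∑ v, dpn n ω v = ∑ v, dmn n ω v)
    (Ehn : (n : ℕ) → Ω → (Fin n × Fin n → ℕ))
    (hEh : ∀ n, Measurable (Ehn n))
    (hCM : ∀ n (g : (Fin n × Fin n → ℕ) → ℝ), (∃ C, ∀ x, |g x| ≤ C) →
      μ[(fun ω => g (Ehn n ω)) |
          MeasurableSpace.comap (fun ω => (dpn n ω, dmn n ω)) inferInstance] =ᵐ[μ]
        fun ω => ∫ σ, g (pairingMult (dpn n ω) (dmn n ω) σ)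
          ∂ uniformPairing (dpn n ω) (dmn n ω))
    (hminf : ∀ K : ℕ, Tendsto (fun n => μ {ω | (∑ v, dpn n ω v) < K}) atTop (nhds 0))
    (α β : Bool) (k l : ℕ) :
    TendstoInMeasure μ
      (fun n ω =>
        (μ[(fun ω' => (phiCM (dpn n ω') (dmn n ω') α β k l (Ehn n ω')) ^ 2) |
            MeasurableSpace.comap (fun ω' => (dpn n ω', dmn n ω')) inferInstance]) ω -
        ((μ[(fun ω' => phiCM (dpn n ω') (dmn n ω') α β k l (Ehn n ω')) |
            MeasurableSpace.comap (fun ω' => (dpn n ω', dmn n ω')) inferInstance]) ω) ^ 2)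
      atTop (fun _ => 0) := by
  have hv : ∀ n, ∀ᵐ ω ∂μ, 0 < ∑ v, dpn n ω v →
      |(μ[(fun ω' => (phiCM (dpn n ω') (dmn n ω') α β k l (Ehn n ω')) ^ 2) |
            MeasurableSpace.comap (fun ω' => (dpn n ω', dmn n ω')) inferInstance]) ω -
        ((μ[(fun ω' => phiCM (dpn n ω') (dmn n ω') α β k l (Ehn n ω')) |
            MeasurableSpace.comap (fun ω' => (dpn n ω', dmn n ω')) inferInstance]) ω) ^ 2| ≤
        1 / (∑ v, dpn n ω v : ℕ) := by
    intro n
    have h1 := cm_condExp μ n (dpn n) (dmn n) (hdp n) (hdm n) (Ehn n) (hEh n) (hCM n)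
      (fun d x => phiCM d.1 d.2 α β k l x) (fun d σ => cm_phi_bound d.1 d.2 α β k l σ)
    have h2 := cm_condExp μ n (dpn n) (dmn n) (hdp n) (hdm n) (Ehn n) (hEh n) (hCM n)
      (fun d x => phiCM d.1 d.2 α β k l x ^ 2) (fun d σ => by
        rw [abs_pow]
        exact pow_le_one₀ (abs_nonneg _) (cm_phi_bound d.1 d.2 α β k l σ))
    filter_upwards [h1, h2] with ω a b hpos
    rw [a, b]
    exact cm_var_bound (dpn n ω) (dmn n ω) α β k l (htot n ω) hpos
  rw [tendstoInMeasure_iff_norm]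
  intro ε hε
  obtain ⟨K, hK⟩ := exists_nat_gt (1 / ε)
  have hK0 : (0 : ℝ) < K := lt_trans (by positivity) hK
  refine tendsto_of_tendsto_of_tendsto_of_le_of_le tendsto_const_nhds (hminf K)
    (fun _ => zero_le) (fun n => ?_)
  refine measure_mono_ae ?_
  filter_upwards [hv n] with ω hω hbad
  by_contra hcon
  have hge : K ≤ ∑ v, dpn n ω v := not_lt.1 hcon
  have hgeR : (K : ℝ) ≤ ((∑ v, dpn n ω v : ℕ) : ℝ) := by exact_mod_cast hge
  have hpos : 0 < ∑ v, dpn n ω v := lt_of_lt_of_le (by exact_mod_cast hK0) hge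
  have h1 := hω hpos
  have h2 : (1 : ℝ) / ((∑ v, dpn n ω v : ℕ) : ℝ) < ε := by
    rw [div_lt_iff₀ (lt_of_lt_of_le hK0 hgeR)]
    rw [div_lt_iff₀ hε] at hK
    nlinarith
  have hbad' : ε ≤ ‖_ - (0 : ℝ)‖ := hbad
  rw [sub_zero, Real.norm_eq_abs] at hbad'
  linarith
end

section
/- For each n, let (d_n⁺(v),d_n⁻(v))_{v∈V_n}, |V_n|=n, be random bi-degree sequences with equal totals m_n satisfying the bi-degree regularity hypotheses with limit variables ξ,γ. Then for every α,β∈{+,−} and all k,l∈ℕ, Σ_{e∈V_n×V_n} I_e^{α,β}(k,l)·d_n⁺(π_*e)·d_n⁻(π*e)/m_n² → P(𝒟^α=k)·P(𝒟^β=l) in probability as n→∞, where 𝒟^α,𝒟^β are given by the size-biasing table. -/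
open Finset MeasureTheory ProbabilityTheory Filter

/-- `P(X = k)` as a real number. -/
noncomputable def pmfOf {Ω' : Type*} [MeasurableSpace Ω'] (ν : Measure Ω')
    (X : Ω' → ℕ) (k : ℕ) : ℝ :=
  (ν {ω | X ω = k}).toReal

/-- The source limit degree distribution `P(𝒟^α = k)` from the size-biasing table:
`k·P(ξ=k)/E[ξ]` if `α = +`, and `P(γ=k)` if `α = −`. -/
noncomputable def srcLimit {Ω' : Type*} [MeasurableSpace Ω'] (ν : Measure Ω')
    (xi gam : Ω' → ℕ) (α : Bool) (k : ℕ) : ℝ :=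
  if α then (k : ℝ) * pmfOf ν xi k / ∫ ω, (xi ω : ℝ) ∂ν else pmfOf ν gam k

/-- The target limit degree distribution `P(𝒟^β = l)` from the size-biasing table:
`P(ξ=l)` if `β = +`, and `l·P(γ=l)/E[γ]` if `β = −`. -/
noncomputable def tgtLimit {Ω' : Type*} [MeasurableSpace Ω'] (ν : Measure Ω')
    (xi gam : Ω' → ℕ) (β : Bool) (l : ℕ) : ℝ :=
  if β then pmfOf ν xi l else (l : ℝ) * pmfOf ν gam l / ∫ ω, (gam ω : ℝ) ∂ν

open Topology in
/-- The filter on `ℕ × Ω` of events whose complement has probability tending to zero. -/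
def probFilter {Ω : Type*} [MeasurableSpace Ω] (μ : Measure Ω) : Filter (ℕ × Ω) where
  sets := {S | Tendsto (fun n => μ {ω | (n, ω) ∉ S}) atTop (𝓝 0)}
  univ_sets := by simp
  sets_of_superset := by
    intro S T hS hST
    refine tendsto_of_tendsto_of_tendsto_of_le_of_le tendsto_const_nhds hS (fun _ => zero_le) ?_
    intro n
    exact measure_mono (fun ω hω h => hω (hST h))
  inter_sets := by
    intro S T hS hT
    have h := Tendsto.add hS hT
    rw [add_zero] at h
    refine tendsto_of_tendsto_of_tendsto_of_le_of_le tendsto_const_nhds h (fun _ => zero_le) ?_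
    intro n
    refine le_trans (measure_mono ?_) (measure_union_le _ _)
    intro ω hω
    by_contra hc
    simp only [Set.mem_union, Set.mem_ofPred_eq, not_or, not_not] at hc
    exact hω hc

open Topology in
theorem mem_probFilter {Ω : Type*} [MeasurableSpace Ω] (μ : Measure Ω) (S : Set (ℕ × Ω)) :
    S ∈ probFilter μ ↔ Tendsto (fun n => μ {ω | (n, ω) ∉ S}) atTop (𝓝 0) := Iff.rfl

open Topology in
theorem tendstoInMeasure_iff_probFilter {Ω : Type*} [MeasurableSpace Ω] (μ : Measure Ω)
    (f : ℕ → Ω → ℝ) (c : ℝ) :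
    TendstoInMeasure μ f atTop (fun _ => c) ↔
      Tendsto (fun t : ℕ × Ω => f t.1 t.2) (probFilter μ) (𝓝 c) := by
  rw [tendstoInMeasure_iff_dist, Metric.tendsto_nhds]
  refine forall_congr' fun ε => forall_congr' fun _ => ?_
  rw [Filter.Eventually, mem_probFilter]
  simp only [Set.mem_ofPred_eq, not_lt]

/-- Singleton expansion of an integral over a countable space. -/
theorem hasSum_countable (M : Measure (ℕ × ℕ)) [IsFiniteMeasure M] (g : ℕ × ℕ → ℝ)
    (hg : Integrable g M) : HasSum (fun x => M.real {x} * g x) (∫ x, g x ∂M) := by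
  have h := hasSum_integral_iUnion (μ := M) (f := g) (s := fun x : ℕ × ℕ => ({x} : Set (ℕ × ℕ)))
    (fun _ => measurableSet_singleton _)
    (fun i j hij => by simpa using hij) hg.integrableOn
  simp only [Set.iUnion_of_singleton, setIntegral_univ, integral_singleton, smul_eq_mul] at h
  exact h

/-- The empirical average. -/
noncomputable def empAvg {n : ℕ} (d : Fin n → ℕ × ℕ) (g : ℕ × ℕ → ℝ) : ℝ :=
  (1 / (n : ℝ)) * ∑ v, g (d v)

theorem empAvg_ge {n : ℕ} (d : Fin n → ℕ × ℕ) (g : ℕ × ℕ → ℝ) (hg : ∀ x, 0 ≤ g x)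
    (S : Finset (ℕ × ℕ)) :
    ∑ x ∈ S, empAvg d (fun y => if y = x then 1 else 0) * g x ≤ empAvg d g := by
  have : ∑ x ∈ S, empAvg d (fun y => if y = x then 1 else 0) * g x
      = (1 / (n : ℝ)) * ∑ v, ∑ x ∈ S, (if d v = x then g x else 0) := by
    rw [Finset.sum_comm, Finset.mul_sum]
    refine Finset.sum_congr rfl fun x _ => ?_
    rw [empAvg, mul_assoc, Finset.sum_mul]
    congr 1
    refine Finset.sum_congr rfl fun v _ => ?_
    split_ifs <;> simp
  rw [this, empAvg]
  refine mul_le_mul_of_nonneg_left (Finset.sum_le_sum fun v _ => ?_) (by positivity)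
  rw [Finset.sum_ite_eq]
  split_ifs
  · exact le_rfl
  · exact hg _

theorem lower_bound {T : Type*} (F : Filter T) (N : T → ℕ) (d : (t : T) → Fin (N t) → ℕ × ℕ)
    (M : Measure (ℕ × ℕ)) [IsFiniteMeasure M]
    (hj : ∀ x, Tendsto (fun t => empAvg (d t) (fun y => if y = x then 1 else 0)) F
      (nhds (M.real {x})))
    (g : ℕ × ℕ → ℝ) (hg : ∀ x, 0 ≤ g x) (hgi : Integrable g M) (a : ℝ) (ha : a < ∫ x, g x ∂M) :
    ∀ᶠ t in F, a < empAvg (d t) g := by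
  obtain ⟨S, hS⟩ := (((tendsto_order.1 (hasSum_countable M g hgi)).1 a ha)).exists
  have h1 : Tendsto (fun t => ∑ x ∈ S, empAvg (d t) (fun y => if y = x then 1 else 0) * g x) F
      (nhds (∑ x ∈ S, M.real {x} * g x)) :=
    tendsto_finsetSum _ fun x _ => (hj x).mul_const _
  filter_upwards [(tendsto_order.1 h1).1 a hS] with t ht
  exact lt_of_lt_of_le ht (empAvg_ge _ g hg S)

/-- Scheffé-type lemma. -/
theorem scheffe_limit {T : Type*} (F : Filter T) (N : T → ℕ) (d : (t : T) → Fin (N t) → ℕ × ℕ)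
    (M : Measure (ℕ × ℕ)) [IsFiniteMeasure M]
    (hj : ∀ x, Tendsto (fun t => empAvg (d t) (fun y => if y = x then 1 else 0)) F
      (nhds (M.real {x})))
    (f g : ℕ × ℕ → ℝ) (hg : ∀ x, 0 ≤ g x) (hgf : ∀ x, g x ≤ f x)
    (hf : Integrable f M)
    (hlim : Tendsto (fun t => empAvg (d t) f) F (nhds (∫ x, f x ∂M))) :
    Tendsto (fun t => empAvg (d t) g) F (nhds (∫ x, g x ∂M)) := by
  have hgi : Integrable g M := by
    refine hf.mono' (Measurable.aestronglyMeasurable (measurable_of_countable g)) ?_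
    refine Eventually.of_forall fun x => ?_
    rw [Real.norm_of_nonneg (hg x)]
    exact hgf x
  refine tendsto_order.2 ⟨fun a ha => lower_bound F N d M hj g hg hgi a ha, fun b hb => ?_⟩
  have h1 := lower_bound F N d M hj (fun x => f x - g x) (fun x => sub_nonneg.2 (hgf x))
    (hf.sub hgi) (∫ x, f x ∂M - ∫ x, g x ∂M - (b - ∫ x, g x ∂M) / 2)
    (by rw [integral_sub hf hgi]; linarith)
  have h2 := (tendsto_order.1 hlim).2 (∫ x, f x ∂M + (b - ∫ x, g x ∂M) / 2) (by linarith)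
  filter_upwards [h1, h2] with t h1 h2
  have h3 : empAvg (d t) (fun x => f x - g x) = empAvg (d t) f - empAvg (d t) g := by
    simp [empAvg, Finset.sum_sub_distrib, mul_sub]
  rw [h3] at h1
  linarith

theorem integral_ind (M : Measure ℕ) (k : ℕ) :
    ∫ x, (if x = k then (1 : ℝ) else 0) ∂M = M.real {k} := by
  have : (fun x : ℕ => if x = k then (1 : ℝ) else 0) = Set.indicator {k} 1 := by
    ext x; simp [Set.indicator_apply]
  rw [this, integral_indicator_one (measurableSet_singleton k)]

theorem integral_ind' (M : Measure ℕ) (k : ℕ) :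
    ∫ x, (if x = k then (x : ℝ) else 0) ∂M = k * M.real {k} := by
  rw [← integral_ind, ← integral_const_mul]
  congr 1
  ext x
  split_ifs with h <;> simp [h]

theorem map_real_eq {Ω' : Type*} [MeasurableSpace Ω'] (ν : Measure Ω') (X : Ω' → ℕ)
    (hX : Measurable X) (k : ℕ) : (ν.map X).real {k} = pmfOf ν X k := by
  rw [Measure.real, Measure.map_apply hX (measurableSet_singleton k)]; rfl

/-- Under the bi-degree regularity hypotheses with limit variables
`ξ, γ`, the first-moment expression
`Σ_{e} I_e^{α,β}(k,l)·d_n⁺(π_*e)·d_n⁻(π*e)/m_n²` converges in probability to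
`P(𝒟^α = k)·P(𝒟^β = l)` given by the size-biasing table. -/
theorem cm_first_moment_limit
    {Ω : Type*} [MeasurableSpace Ω] (μ : Measure Ω) [IsProbabilityMeasure μ]
    {Ω' : Type*} [MeasurableSpace Ω'] (ν : Measure Ω') [IsProbabilityMeasure ν]
    (dpn dmn : (n : ℕ) → Ω → (Fin n → ℕ))
    (hdp : ∀ n, Measurable (dpn n)) (hdm : ∀ n, Measurable (dmn n))
    (htot : ∀ n ω, ∑ v, dpn n ω v = ∑ v, dmn n ω v)
    (xi gam : Ω' → ℕ) (hxi : Measurable xi) (hgam : Measurable gam)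
    (hxiInt : Integrable (fun ω => (xi ω : ℝ)) ν)
    (hgamInt : Integrable (fun ω => (gam ω : ℝ)) ν)
    (hpos : 0 < ∫ ω, (xi ω : ℝ) ∂ν)
    (heq : ∫ ω, (xi ω : ℝ) ∂ν = ∫ ω, (gam ω : ℝ) ∂ν)
    (hjoint : ∀ k l : ℕ, TendstoInMeasure μ
      (fun (n : ℕ) ω => (1 / (n : ℝ)) * ∑ v : Fin n,
        if dpn n ω v = k ∧ dmn n ω v = l then (1 : ℝ) else 0) atTop
      (fun _ => pmfOf ν xi k * pmfOf ν gam l))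
    (havgp : TendstoInMeasure μ
      (fun (n : ℕ) ω => (1 / (n : ℝ)) * ∑ v : Fin n, (dpn n ω v : ℝ)) atTop
      (fun _ => ∫ ω, (xi ω : ℝ) ∂ν))
    (havgm : TendstoInMeasure μ
      (fun (n : ℕ) ω => (1 / (n : ℝ)) * ∑ v : Fin n, (dmn n ω v : ℝ)) atTop
      (fun _ => ∫ ω, (gam ω : ℝ) ∂ν))
    (α β : Bool) (k l : ℕ) :
    TendstoInMeasure μ
      (fun n ω => ∑ e : Fin n × Fin n, indCM (dpn n ω) (dmn n ω) α β k l e *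
        ((dpn n ω e.1 : ℝ) * (dmn n ω e.2 : ℝ)) / ((∑ v, dpn n ω v : ℕ) : ℝ) ^ 2)
      atTop (fun _ => srcLimit ν xi gam α k * tgtLimit ν xi gam β l) := by
  classical
  rw [tendstoInMeasure_iff_probFilter] at havgp havgm ⊢
  simp only [tendstoInMeasure_iff_probFilter] at hjoint
  set P := ν.map xi with hP
  set Q := ν.map gam with hQ
  have : IsProbabilityMeasure P := Measure.isProbabilityMeasure_map hxi.aemeasurable
  have : IsProbabilityMeasure Q := Measure.isProbabilityMeasure_map hgam.aemeasurable
  set E := ∫ ω, (xi ω : ℝ) ∂ν with hE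
  have hmeas : Measurable (fun x : ℕ => (x : ℝ)) := measurable_of_countable _
  have hPE : ∫ x, (x : ℝ) ∂P = E := integral_map hxi.aemeasurable hmeas.aestronglyMeasurable
  have hQE : ∫ x, (x : ℝ) ∂Q = E := by
    rw [heq]; exact integral_map hgam.aemeasurable hmeas.aestronglyMeasurable
  have hPi : Integrable (fun x : ℕ => (x : ℝ)) P :=
    (integrable_map_measure hmeas.aestronglyMeasurable hxi.aemeasurable).2 hxiInt
  have hQi : Integrable (fun x : ℕ => (x : ℝ)) Q :=
    (integrable_map_measure hmeas.aestronglyMeasurable hgam.aemeasurable).2 hgamInt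
  set F := probFilter μ
  let d : (t : ℕ × Ω) → Fin t.1 → ℕ × ℕ := fun t v => (dpn t.1 t.2 v, dmn t.1 t.2 v)
  have hj : ∀ x, Tendsto (fun t => empAvg (d t) (fun y => if y = x then 1 else 0)) F
      (nhds ((P.prod Q).real {x})) := by
    rintro ⟨i, j⟩
    have h1 : (P.prod Q).real {(i, j)} = pmfOf ν xi i * pmfOf ν gam j := by
      rw [← Set.singleton_prod_singleton, measureReal_prod_prod, map_real_eq ν xi hxi,
        map_real_eq ν gam hgam]
    rw [h1]
    refine (hjoint i j).congr fun t => ?_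
    simp [empAvg, d]
  have hfp : Integrable (fun x : ℕ × ℕ => (x.1 : ℝ)) (P.prod Q) := hPi.comp_fst Q
  have hfm : Integrable (fun x : ℕ × ℕ => (x.2 : ℝ)) (P.prod Q) := hQi.comp_snd P
  have hIp : ∫ x : ℕ × ℕ, (x.1 : ℝ) ∂(P.prod Q) = E := by
    rw [integral_fun_fst (f := fun x : ℕ => (x : ℝ))]; simpa using hPE
  have hIm : ∫ x : ℕ × ℕ, (x.2 : ℝ) ∂(P.prod Q) = E := by
    rw [integral_fun_snd (f := fun x : ℕ => (x : ℝ))]; simpa using hQE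
  have hlp : Tendsto (fun t => empAvg (d t) (fun x => (x.1 : ℝ))) F (nhds E) := havgp
  have hlm : Tendsto (fun t => empAvg (d t) (fun x => (x.2 : ℝ))) F (nhds E) := by
    rw [heq]; exact havgm
  have hA := scheffe_limit F (fun t => t.1) d (P.prod Q) hj (fun x => (x.1 : ℝ))
    (fun x => if (if α then x.1 else x.2) = k then (x.1 : ℝ) else 0)
    (fun x => by split_ifs <;> positivity)
    (fun x => by split_ifs <;> first | exact le_rfl | positivity) hfp
    (by rw [hIp]; exact hlp)
  have hB := scheffe_limit F (fun t => t.1) d (P.prod Q) hj (fun x => (x.2 : ℝ))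
    (fun x => if (if β then x.1 else x.2) = l then (x.2 : ℝ) else 0)
    (fun x => by split_ifs <;> positivity)
    (fun x => by split_ifs <;> first | exact le_rfl | positivity) hfm
    (by rw [hIm]; exact hlm)
  have hAv : ∫ x : ℕ × ℕ, (if (if α then x.1 else x.2) = k then (x.1 : ℝ) else 0) ∂(P.prod Q)
      = srcLimit ν xi gam α k * E := by
    cases α
    · have := integral_prod_mul (μ := P) (ν := Q) (fun x : ℕ => (x : ℝ))
        (fun y => if y = k then (1 : ℝ) else 0)
      rw [integral_ind, hPE, map_real_eq ν gam hgam] at this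
      simpa [srcLimit, mul_comm] using this
    · have := integral_fun_fst (μ := P) (ν := Q) (fun x : ℕ => if x = k then (x : ℝ) else 0)
      rw [integral_ind', map_real_eq ν xi hxi] at this
      simp only [if_true, srcLimit]
      rw [this, ← hE, div_mul_cancel₀ _ hpos.ne']
      simp
  have hBv : ∫ x : ℕ × ℕ, (if (if β then x.1 else x.2) = l then (x.2 : ℝ) else 0) ∂(P.prod Q)
      = tgtLimit ν xi gam β l * E := by
    cases β
    · have := integral_fun_snd (μ := P) (ν := Q) (fun x : ℕ => if x = l then (x : ℝ) else 0)
      rw [integral_ind', map_real_eq ν gam hgam] at this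
      simp only [Bool.false_eq_true, if_false, tgtLimit]
      rw [this, ← heq, div_mul_cancel₀ _ hpos.ne']
      simp
    · have := integral_prod_mul (μ := P) (ν := Q) (fun y => if y = l then (1 : ℝ) else 0)
        (fun x : ℕ => (x : ℝ))
      rw [integral_ind, hQE, map_real_eq ν xi hxi] at this
      simpa [tgtLimit, mul_comm] using this
  rw [hAv] at hA
  rw [hBv] at hB
  have hfin := (hA.mul hB).div (hlp.pow 2) (pow_ne_zero 2 hpos.ne')
  have hval : srcLimit ν xi gam α k * E * (tgtLimit ν xi gam β l * E) / E ^ 2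
      = srcLimit ν xi gam α k * tgtLimit ν xi gam β l := by
    have := hpos.ne'
    field_simp
  rw [hval] at hfin
  refine hfin.congr fun t => ?_
  obtain ⟨n, ω⟩ := t
  rw [← Finset.sum_div]
  have hnum : ∑ e : Fin n × Fin n, indCM (dpn n ω) (dmn n ω) α β k l e *
        ((dpn n ω e.1 : ℝ) * (dmn n ω e.2 : ℝ)) =
      (∑ v : Fin n, if (if α then dpn n ω v else dmn n ω v) = k then (dpn n ω v : ℝ) else 0) *
      (∑ v : Fin n, if (if β then dpn n ω v else dmn n ω v) = l then (dmn n ω v : ℝ) else 0) := by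
    rw [Finset.sum_mul_sum, ← Finset.univ_product_univ, Finset.sum_product]
    refine Finset.sum_congr rfl fun v _ => Finset.sum_congr rfl fun w _ => ?_
    simp only [indCM, bideg, ite_and]
    split_ifs <;> simp
  rw [hnum]
  simp only [Pi.div_apply, empAvg, d, Nat.cast_sum]
  rcases Nat.eq_zero_or_pos n with rfl | hn
  · simp
  · have : (n : ℝ) ≠ 0 := by positivity
    rw [mul_pow, mul_mul_mul_comm, ← pow_two, mul_div_mul_left _ _ (by positivity)]
end

section
/- For each n, let (d_n⁺(v),d_n⁻(v))_{v∈V_n}, |V_n|=n, be random bi-degree sequences with equal totals m_n satisfying the bi-degree regularity hypotheses with limit variables ξ,γ, and conditionally on them let Ê_n be the directed configuration model edge multiplicities from uniformly random stub pairings. Then for every α,β∈{+,−} and all k,l∈ℕ: (i) lim_{n→∞} E[Φ_n^{α,β}(k,l)] = P(𝒟^α=k)·P(𝒟^β=l); (ii) lim_{n→∞} E[Φ_n^{α,β}(k,l)²] = P(𝒟^α=k)²·P(𝒟^β=l)²; and consequently Φ_n^{α,β}(k,l) → P(𝒟^α=k)·P(𝒟^β=l) in probability, where 𝒟^α,𝒟^β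 are given by the size-biasing table. -/
open Finset MeasureTheory ProbabilityTheory Filter

/-- Negative-correlation variance bound for uniformly random bijections (un-normalised). -/
lemma equiv_var_bound {S T : Type*} [Fintype S] [Fintype T] [DecidableEq S] [DecidableEq T]
    (A : S → ℝ) (hA0 : ∀ s, 0 ≤ A s) (hA1 : ∀ s, A s ≤ 1)
    (u : T → ℝ) (hu : ∑ t, u t = 0) (hu1 : ∀ t, u t ^ 2 ≤ 1) :
    ∑ σ : S ≃ T, (∑ s, A s * u (σ s)) ^ 2
      ≤ (Fintype.card (S ≃ T) : ℝ) * Fintype.card S := by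
  have hneg : ∀ s s' : S, s' ≠ s → ∑ σ : S ≃ T, u (σ s) * u (σ s') ≤ 0 := by
    intro s s' hs
    have hconst : ∀ s'' : S, s'' ≠ s →
        ∑ σ : S ≃ T, u (σ s) * u (σ s'') = ∑ σ : S ≃ T, u (σ s) * u (σ s') := by
      intro s'' hs''
      refine Fintype.sum_equiv (Equiv.equivCongr (Equiv.swap s' s'') (Equiv.refl T)) _ _ ?_
      intro σ
      simp [Equiv.equivCongr, Equiv.swap_apply_of_ne_of_ne hs.symm hs''.symm]
    have hz : ∑ s'', ∑ σ : S ≃ T, u (σ s) * u (σ s'') = 0 := by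
      rw [Finset.sum_comm]
      refine Finset.sum_eq_zero fun σ _ => ?_
      rw [← Finset.mul_sum, Equiv.sum_comp σ u, hu, mul_zero]
    rw [← Finset.add_sum_erase _ _ (Finset.mem_univ s),
      Finset.sum_congr rfl (fun s'' h => hconst s'' (Finset.ne_of_mem_erase h)),
      Finset.sum_const, nsmul_eq_mul] at hz
    have h1 : 0 ≤ ∑ σ : S ≃ T, u (σ s) * u (σ s) :=
      Finset.sum_nonneg fun σ _ => mul_self_nonneg _
    have h2 : 0 < ((Finset.univ.erase s).card : ℝ) := by
      exact_mod_cast Finset.card_pos.mpr ⟨s', by simp [hs]⟩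
    by_contra hcon
    push Not at hcon
    have := mul_pos h2 hcon
    linarith
  have hpair : ∀ s s' : S, ∑ σ : S ≃ T, (A s * u (σ s)) * (A s' * u (σ s'))
      ≤ if s' = s then (Fintype.card (S ≃ T) : ℝ) else 0 := by
    intro s s'
    have e : ∑ σ : S ≃ T, (A s * u (σ s)) * (A s' * u (σ s'))
        = A s * A s' * ∑ σ : S ≃ T, u (σ s) * u (σ s') := by
      rw [Finset.mul_sum]; exact Finset.sum_congr rfl fun _ _ => by ring
    rw [e]
    split_ifs with h
    · subst h
      have h3 : ∑ σ : S ≃ T, u (σ s') * u (σ s') ≤ (Fintype.card (S ≃ T) : ℝ) := by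
        calc _ ≤ ∑ σ : S ≃ T, (1 : ℝ) :=
              Finset.sum_le_sum fun σ _ => by have := hu1 (σ s'); nlinarith
          _ = _ := by simp
      have h4 : 0 ≤ ∑ σ : S ≃ T, u (σ s') * u (σ s') :=
        Finset.sum_nonneg fun σ _ => mul_self_nonneg _
      have h5 : A s' * A s' ≤ 1 := mul_le_one₀ (hA1 _) (hA0 _) (hA1 _)
      calc _ ≤ 1 * ∑ σ : S ≃ T, u (σ s') * u (σ s') := by gcongr
        _ ≤ _ := by linarith
    · exact mul_nonpos_of_nonneg_of_nonpos (mul_nonneg (hA0 _) (hA0 _)) (hneg s s' h)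
  calc ∑ σ : S ≃ T, (∑ s, A s * u (σ s)) ^ 2
      = ∑ s, ∑ s', ∑ σ : S ≃ T, (A s * u (σ s)) * (A s' * u (σ s')) := by
        simp_rw [sq, Finset.sum_mul_sum]
        rw [Finset.sum_comm]
        refine Finset.sum_congr rfl fun s _ => ?_
        rw [Finset.sum_comm]
    _ ≤ ∑ s : S, ∑ s' : S, if s' = s then (Fintype.card (S ≃ T) : ℝ) else 0 :=
        Finset.sum_le_sum fun s _ => Finset.sum_le_sum fun s' _ => hpair s s'
    _ = _ := by simp [mul_comm]

/-- number of outbound stubs with source of `α`-degree `k`. -/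
def aCM {V : Type*} [Fintype V] (dp dm : V → ℕ) (α : Bool) (k : ℕ) : ℝ :=
  ∑ v, if bideg dp dm α v = k then (dp v : ℝ) else 0

/-- number of inbound stubs with target of `β`-degree `l`. -/
def bCM {V : Type*} [Fintype V] (dp dm : V → ℕ) (β : Bool) (l : ℕ) : ℝ :=
  ∑ v, if bideg dp dm β v = l then (dm v : ℝ) else 0

/-- total number of stubs -/
def mCM {V : Type*} [Fintype V] (dp : V → ℕ) : ℝ := ∑ v, (dp v : ℝ)

lemma phi_pairing {V : Type*} [Fintype V] [DecidableEq V] (dp dm : V → ℕ) (α β : Bool)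
    (k l : ℕ) (σ : OutStub dp ≃ InStub dm) :
    phiCM dp dm α β k l (pairingMult dp dm σ) =
      (∑ s : OutStub dp, (if bideg dp dm α s.1 = k then (1 : ℝ) else 0) *
        (if bideg dp dm β (σ s).1 = l then 1 else 0)) / mCM dp := by
  unfold phiCM mCM
  rw [← Finset.sum_div]
  congr 1
  rw [Fintype.sum_prod_type, Fintype.sum_sigma]
  refine Finset.sum_congr rfl fun v _ => ?_
  simp only [indCM, pairingMult, Finset.card_filter, Nat.cast_sum, Finset.mul_sum]
  refine (Finset.sum_comm (s := (univ : Finset V)) (t := (univ : Finset (Fin (dp v))))).trans ?_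
  refine Finset.sum_congr rfl fun i _ => ?_
  rw [Finset.sum_eq_single (σ ⟨v, i⟩).1]
  · simp only [if_true, Nat.cast_one, mul_one]
    split_ifs <;> simp_all
  · intro w _ hw; simp [hw.symm]
  · simp

lemma card_outStub {V : Type*} [Fintype V] (dp : V → ℕ) :
    (Fintype.card (OutStub dp) : ℝ) = mCM dp := by
  simp [mCM]

lemma integral_uniform {V : Type*} [Fintype V] [DecidableEq V] (dp dm : V → ℕ)
    (f : (OutStub dp ≃ InStub dm) → ℝ) :
    ∫ σ, f σ ∂ uniformPairing dp dm =
      (Fintype.card (OutStub dp ≃ InStub dm) : ℝ)⁻¹ * ∑ σ, f σ := by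
  have : DiscreteMeasurableSpace (OutStub dp ≃ InStub dm) := ⟨fun _ => trivial⟩
  unfold uniformPairing
  rw [integral_smul_measure, integral_count]
  simp

lemma mCM_nonneg {V : Type*} [Fintype V] (dp : V → ℕ) : 0 ≤ mCM dp :=
  Finset.sum_nonneg fun _ _ => Nat.cast_nonneg _

lemma phi_pairing_le_one {V : Type*} [Fintype V] [DecidableEq V] (dp dm : V → ℕ) (α β : Bool)
    (k l : ℕ) (σ : OutStub dp ≃ InStub dm) :
    phiCM dp dm α β k l (pairingMult dp dm σ) ≤ 1 := by
  rw [phi_pairing]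
  refine div_le_one_of_le₀ ?_ (mCM_nonneg dp)
  rw [← card_outStub]
  calc _ ≤ ∑ s : OutStub dp, (1 : ℝ) := Finset.sum_le_sum fun s _ => by split_ifs <;> norm_num
    _ = _ := by simp

lemma bCM_le {V : Type*} [Fintype V] (dp dm : V → ℕ) (β : Bool) (l : ℕ) :
    bCM dp dm β l ≤ mCM dm :=
  Finset.sum_le_sum fun v _ => by split_ifs <;> simp

lemma bCM_nonneg {V : Type*} [Fintype V] (dp dm : V → ℕ) (β : Bool) (l : ℕ) :
    0 ≤ bCM dp dm β l :=
  Finset.sum_nonneg fun v _ => by split_ifs <;> simp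

lemma pairing_var {V : Type*} [Fintype V] [DecidableEq V] (dp dm : V → ℕ)
    (htot : ∑ v, dp v = ∑ v, dm v) (α β : Bool) (k l : ℕ) :
    ∫ σ, min ((phiCM dp dm α β k l (pairingMult dp dm σ)
        - aCM dp dm α k * bCM dp dm β l / mCM dp ^ 2) ^ 2) 1 ∂ uniformPairing dp dm
      ≤ 1 / mCM dp := by
  have htot' : mCM dp = mCM dm := by unfold mCM; exact_mod_cast htot
  rw [integral_uniform]
  rcases (mCM_nonneg dp).eq_or_lt with h0 | hm
  · have : ∀ σ, phiCM dp dm α β k l (pairingMult dp dm σ) = 0 := fun σ => by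
      rw [phi_pairing, ← h0, div_zero]
    simp [this, ← h0]
  set m := mCM dp with hmdef
  set b := bCM dp dm β l with hb
  let A : OutStub dp → ℝ := fun s => if bideg dp dm α s.1 = k then 1 else 0
  let u : InStub dm → ℝ := fun t => (if bideg dp dm β t.1 = l then 1 else 0) - b / m
  have hb0 : 0 ≤ b / m := div_nonneg (bCM_nonneg ..) hm.le
  have hb1 : b / m ≤ 1 := div_le_one_of_le₀ (by rw [htot']; exact bCM_le ..) hm.le
  have hu : ∑ t, u t = 0 := by
    simp only [u, Finset.sum_sub_distrib, Finset.sum_const, Finset.card_univ, nsmul_eq_mul,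
      card_outStub dm]
    rw [← htot', mul_div_cancel₀ _ hm.ne', Fintype.sum_sigma, sub_eq_zero, hb, bCM]
    refine Finset.sum_congr rfl fun v _ => ?_
    split_ifs <;> simp
  have hA : ∑ s, A s = aCM dp dm α k := by
    simp only [A, Fintype.sum_sigma, aCM]
    refine Finset.sum_congr rfl fun v _ => ?_
    split_ifs <;> simp
  have key := equiv_var_bound A (fun s => by simp only [A]; split_ifs <;> norm_num)
    (fun s => by simp only [A]; split_ifs <;> norm_num) u hu
    (fun t => by simp only [u]; split_ifs <;> nlinarith)
  rw [card_outStub] at key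
  have hphi : ∀ σ, phiCM dp dm α β k l (pairingMult dp dm σ) - aCM dp dm α k * b / m ^ 2
      = (∑ s, A s * u (σ s)) / m := by
    intro σ
    rw [phi_pairing, ← hmdef]
    simp only [u, mul_sub, Finset.sum_sub_distrib, ← Finset.sum_mul, hA]
    simp only [A]
    field_simp
  have hle : ∑ σ : OutStub dp ≃ InStub dm, min ((phiCM dp dm α β k l (pairingMult dp dm σ)
        - aCM dp dm α k * b / m ^ 2) ^ 2) 1
      ≤ (Fintype.card (OutStub dp ≃ InStub dm) : ℝ) * (1 / m) := by
    calc _ ≤ ∑ σ : OutStub dp ≃ InStub dm, (∑ s, A s * u (σ s)) ^ 2 / m ^ 2 :=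
          Finset.sum_le_sum fun σ _ => (min_le_left _ _).trans (by rw [hphi, div_pow])
      _ = (∑ σ : OutStub dp ≃ InStub dm, (∑ s, A s * u (σ s)) ^ 2) / m ^ 2 := by
          rw [Finset.sum_div]
      _ ≤ ((Fintype.card (OutStub dp ≃ InStub dm) : ℝ) * m) / m ^ 2 := by gcongr
      _ = _ := by field_simp
  calc _ ≤ (Fintype.card (OutStub dp ≃ InStub dm) : ℝ)⁻¹ *
        ((Fintype.card (OutStub dp ≃ InStub dm) : ℝ) * (1 / m)) := by gcongr
    _ ≤ 1 / m := by
        rw [← mul_assoc]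
        exact mul_le_of_le_one_left (by positivity) inv_mul_le_one

/-- The filter of events holding with probability tending to one. -/
def whp {Ω : Type*} [MeasurableSpace Ω] (μ : Measure Ω) : Filter (ℕ × Ω) where
  sets := {U | Tendsto (fun n => μ {ω | (n, ω) ∉ U}) atTop (nhds 0)}
  univ_sets := by simp
  sets_of_superset := by
    intro U W hU hUW
    refine tendsto_of_tendsto_of_tendsto_of_le_of_le tendsto_const_nhds hU (fun _ => zero_le)
      (fun n => measure_mono fun ω h h' => h (hUW h'))
  inter_sets := by
    intro U W hU hW
    have := Tendsto.add hU hW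
    rw [add_zero] at this
    refine tendsto_of_tendsto_of_tendsto_of_le_of_le tendsto_const_nhds this (fun _ => zero_le)
      (fun n => le_trans (measure_mono ?_) (measure_union_le _ _))
    intro ω h
    by_cases h1 : (n, ω) ∈ U
    · right; exact fun h2 => h ⟨h1, h2⟩
    · left; exact h1

lemma whp_fst {Ω : Type*} [MeasurableSpace Ω] (μ : Measure Ω) :
    Tendsto (Prod.fst : ℕ × Ω → ℕ) (whp μ) atTop := by
  rw [tendsto_atTop]
  intro N
  change Tendsto (fun n => μ {ω | (n, ω) ∉ {x : ℕ × Ω | N ≤ x.1}}) atTop (nhds 0)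
  refine tendsto_const_nhds.congr' ?_
  filter_upwards [eventually_ge_atTop N] with n hn
  simp [hn]

lemma whp_iff {Ω : Type*} [MeasurableSpace Ω] (μ : Measure Ω) (f : ℕ → Ω → ℝ) (c : ℝ) :
    TendstoInMeasure μ f atTop (fun _ => c) ↔
      Tendsto (fun x : ℕ × Ω => f x.1 x.2) (whp μ) (nhds c) := by
  rw [tendstoInMeasure_iff_dist, Metric.tendsto_nhds]
  refine forall₂_congr fun ε hε => ?_
  change _ ↔ Tendsto (fun n => μ {ω | (n, ω) ∉ {x : ℕ × Ω | dist (f x.1 x.2) c < ε}}) atTop _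
  simp

/-- Fatou-type lower bound along a filter. -/
lemma sum_lower {X ι : Type*} {L : Filter X} {g : X → ι → ℝ} {G : X → ℝ} {d : ι → ℝ} {D : ℝ}
    (hg0 : ∀ x j, 0 ≤ g x j) (hG : ∀ x, HasSum (g x) (G x)) (hd : HasSum d D)
    (hlim : ∀ j, Tendsto (fun x => g x j) L (nhds (d j))) {e : ℝ} (he : 0 < e) :
    ∀ᶠ x in L, D - e < G x := by
  obtain ⟨T, hT⟩ := (hd.eventually (lt_mem_nhds (show D - e < D by linarith))).exists
  have h1 : Tendsto (fun x => ∑ j ∈ T, g x j) L (nhds (∑ j ∈ T, d j)) :=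
    tendsto_finsetSum _ fun j _ => hlim j
  filter_upwards [h1.eventually (lt_mem_nhds hT)] with x hx
  exact hx.trans_le (sum_le_hasSum T (fun j _ => hg0 x j) (hG x))

lemma sum_scheffe {X ι : Type*} {L : Filter X} {f g : X → ι → ℝ} {F G : X → ℝ}
    {c d : ι → ℝ} {C D : ℝ}
    (hg0 : ∀ x j, 0 ≤ g x j) (hgf : ∀ x j, g x j ≤ f x j)
    (hF : ∀ x, HasSum (f x) (F x)) (hG : ∀ x, HasSum (g x) (G x))
    (hc : HasSum c C) (hd : HasSum d D)
    (hflim : ∀ j, Tendsto (fun x => f x j) L (nhds (c j)))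
    (hglim : ∀ j, Tendsto (fun x => g x j) L (nhds (d j)))
    (hFlim : Tendsto F L (nhds C)) : Tendsto G L (nhds D) := by
  rw [Metric.tendsto_nhds]
  intro ε hε
  have h1 := sum_lower hg0 hG hd hglim (half_pos hε)
  have h2 := sum_lower (g := fun x j => f x j - g x j) (fun x j => sub_nonneg.2 (hgf x j))
    (fun x => (hF x).sub (hG x)) (hc.sub hd) (fun j => (hflim j).sub (hglim j)) (half_pos hε)
  have h3 := hFlim.eventually (gt_mem_nhds (show C < C + ε / 2 by linarith))
  filter_upwards [h1, h2, h3] with x h1 h2 h3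
  rw [Real.dist_eq, abs_lt]
  constructor <;> linarith

lemma tendsto_integral_bdd {Ω : Type*} [MeasurableSpace Ω] (μ : Measure Ω)
    [IsProbabilityMeasure μ] {f : ℕ → Ω → ℝ} {c : ℝ}
    (hm : ∀ n, Measurable (f n)) (hb : ∀ n, ∀ᵐ ω ∂μ, |f n ω| ≤ 1)
    (h : TendstoInMeasure μ f atTop (fun _ => c)) :
    Tendsto (fun n => ∫ ω, f n ω ∂μ) atTop (nhds c) := by
  refine tendsto_of_subseq_tendsto fun ns hns => ?_
  obtain ⟨ms, -, hms⟩ := (h.comp hns).exists_seq_tendsto_ae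
  refine ⟨ms, ?_⟩
  have := tendsto_integral_of_dominated_convergence (μ := μ) (fun _ => (1 : ℝ))
    (F := fun n => f (ns (ms n))) (f := fun _ => c)
    (fun n => (hm _).aestronglyMeasurable) (integrable_const _) (fun n => hb _) hms
  simpa using this

/-- Disintegration inequality. -/
lemma disint {Ω D X : Type*} [MeasurableSpace Ω] (μ : Measure Ω) [IsProbabilityMeasure μ]
    [MeasurableSpace D] [MeasurableSpace X] [Countable D] [Countable X]
    [MeasurableSingletonClass D] [MeasurableSingletonClass X]
    (deg : Ω → D) (hdeg : Measurable deg) (E : Ω → X) (hE : Measurable E)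
    (K : D → (X → ℝ) → ℝ)
    (hCM : ∀ g : X → ℝ, (∃ C, ∀ x, |g x| ≤ C) →
      μ[(fun ω => g (E ω)) | MeasurableSpace.comap deg inferInstance] =ᵐ[μ]
        fun ω => K (deg ω) g)
    (F : D → X → ℝ) (hF : ∀ d x, |F d x| ≤ 1) (H : D → ℝ) (hH : ∀ d, |H d| ≤ 1)
    (hKH : ∀ ω, K (deg ω) (F (deg ω)) ≤ H (deg ω)) :
    ∫ ω, F (deg ω) (E ω) ∂μ ≤ ∫ ω, H (deg ω) ∂μ := by
  have hFm : Measurable (fun ω => F (deg ω) (E ω)) :=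
    (Measurable.of_discrete (f := fun p : D × X => F p.1 p.2)).comp (hdeg.prodMk hE)
  have hHm : Measurable (fun ω => H (deg ω)) := (Measurable.of_discrete (f := H)).comp hdeg
  have hFi : Integrable (fun ω => F (deg ω) (E ω)) μ :=
    Integrable.of_bound hFm.aestronglyMeasurable 1 (.of_forall fun ω => hF _ _)
  have hHi : Integrable (fun ω => H (deg ω)) μ :=
    Integrable.of_bound hHm.aestronglyMeasurable 1 (.of_forall fun ω => hH _)
  let s : D → Set Ω := fun d => deg ⁻¹' {d}
  have hs : ∀ d, MeasurableSet (s d) := fun d => hdeg (measurableSet_singleton d)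
  have hU : (⋃ d, s d) = Set.univ := by ext ω; simp [s]
  have hdisj : Pairwise (Function.onFun Disjoint s) := fun a b hab =>
    Disjoint.preimage _ (by simpa using hab)
  have h1 := hasSum_integral_iUnion (μ := μ) hs hdisj hFi.integrableOn
  have h2 := hasSum_integral_iUnion (μ := μ) hs hdisj hHi.integrableOn
  rw [hU, Measure.restrict_univ] at h1 h2
  refine hasSum_le (fun d => ?_) h1 h2
  have hgi : Integrable (fun ω => F d (E ω)) μ :=
    Integrable.of_bound ((Measurable.of_discrete (f := F d)).comp hE).aestronglyMeasurable 1
      (.of_forall fun ω => hF _ _)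
  have e1 : ∫ ω in s d, F (deg ω) (E ω) ∂μ = ∫ ω in s d, F d (E ω) ∂μ :=
    setIntegral_congr_fun (hs d) fun ω hω => by
      have : deg ω = d := hω
      simp only [this]
  have e2 : ∫ ω in s d, F d (E ω) ∂μ = ∫ ω in s d, K (deg ω) (F d) ∂μ := by
    rw [← setIntegral_condExp hdeg.comap_le hgi ⟨{d}, measurableSet_singleton d, rfl⟩]
    exact setIntegral_congr_ae (hs d) ((hCM (F d) ⟨1, hF d⟩).mono fun ω h _ => h)
  rw [e1, e2]
  refine setIntegral_mono_on ?_ hHi.integrableOn (hs d) fun ω hω => ?_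
  · refine (integrableOn_const (C := K d (F d)) (measure_ne_top _ _)).congr_fun ?_ (hs d)
    intro ω hω
    have : deg ω = d := hω
    simp only [this]
  · have : deg ω = d := hω
    have h := hKH ω
    rwa [this] at h ⊢

lemma hasSum_pmf {Ω' : Type*} [MeasurableSpace Ω'] (ν : Measure Ω') [IsProbabilityMeasure ν]
    (X : Ω' → ℕ) (hX : Measurable X) (h : ℕ → ℝ) (hi : Integrable (fun ω => h (X ω)) ν) :
    HasSum (fun i => h i * pmfOf ν X i) (∫ ω, h (X ω) ∂ν) := by
  let s : ℕ → Set Ω' := fun d => X ⁻¹' {d}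
  have hs : ∀ d, MeasurableSet (s d) := fun d => hX (measurableSet_singleton d)
  have hU : (⋃ d, s d) = Set.univ := by ext ω; simp [s]
  have hdisj : Pairwise (Function.onFun Disjoint s) := fun a b hab =>
    Disjoint.preimage _ (by simpa using hab)
  have h1 := hasSum_integral_iUnion (μ := ν) hs hdisj hi.integrableOn
  rw [hU, Measure.restrict_univ] at h1
  refine h1.congr_fun ?_
  intro i
  have : ∫ ω in s i, h (X ω) ∂ν = ∫ ω in s i, h i ∂ν :=
    setIntegral_congr_fun (hs i) fun ω hω => by
      have : X ω = i := hω
      simp only [this]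
  rw [this, setIntegral_const, smul_eq_mul, mul_comm]
  rfl

lemma hasSum_prod_nonneg {p q : ℕ → ℝ} {P Q : ℝ} (hp : ∀ i, 0 ≤ p i) (hq : ∀ i, 0 ≤ q i)
    (h1 : HasSum p P) (h2 : HasSum q Q) : HasSum (fun j : ℕ × ℕ => p j.1 * q j.2) (P * Q) :=
  h1.mul h2 (h1.summable.mul_of_nonneg h2.summable hp hq)

lemma freq_hasSum {n : ℕ} (D : Fin n → ℕ × ℕ) (h : ℕ × ℕ → ℝ) :
    HasSum (fun j => h j * ((1 / (n : ℝ)) * ∑ v, if D v = j then (1 : ℝ) else 0))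
      ((1 / (n : ℝ)) * ∑ v, h (D v)) := by
  have h1 : HasSum (fun j => ∑ v, if j = D v then h (D v) else 0) (∑ v, h (D v)) :=
    hasSum_sum fun v _ => hasSum_ite_eq (D v) (h (D v))
  refine (h1.mul_left (1 / (n : ℝ))).congr_fun ?_
  intro j
  rw [mul_left_comm, Finset.mul_sum]
  congr 1
  refine Finset.sum_congr rfl fun v _ => ?_
  by_cases hv : D v = j
  · simp [hv]
  · simp [hv, Ne.symm hv]

lemma freq_limit {X : Type*} {L : Filter X} (nn : X → ℕ) (D : (x : X) → Fin (nn x) → ℕ × ℕ)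
    (P w : ℕ × ℕ → ℝ) (hw : ∀ j, 0 ≤ w j)
    (hfreq : ∀ j, Tendsto (fun x => (1 / (nn x : ℝ)) *
      ∑ v, if D x v = j then (1 : ℝ) else 0) L (nhds (P j)))
    {C : ℝ} (hC : HasSum (fun j => w j * P j) C)
    (hF : Tendsto (fun x => (1 / (nn x : ℝ)) * ∑ v, w (D x v)) L (nhds C))
    (S : ℕ × ℕ → Prop) [DecidablePred S] {Z : ℝ}
    (hZ : HasSum (fun j => (if S j then w j else 0) * P j) Z) :
    Tendsto (fun x => (1 / (nn x : ℝ)) * ∑ v, if S (D x v) then w (D x v) else 0) L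
      (nhds Z) := by
  have hfr0 : ∀ x j, 0 ≤ (1 / (nn x : ℝ)) * ∑ v, if D x v = j then (1 : ℝ) else 0 :=
    fun x j => mul_nonneg (by positivity)
      (Finset.sum_nonneg fun v _ => by split_ifs <;> norm_num)
  refine sum_scheffe (L := L)
    (f := fun x j => w j * ((1 / (nn x : ℝ)) * ∑ v, if D x v = j then (1 : ℝ) else 0))
    (g := fun x j => (if S j then w j else 0) *
      ((1 / (nn x : ℝ)) * ∑ v, if D x v = j then (1 : ℝ) else 0))
    ?_ ?_ (fun x => freq_hasSum (D x) w)
    (fun x => freq_hasSum (D x) (fun j => if S j then w j else 0)) hC hZ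
    (fun j => (hfreq j).const_mul _) (fun j => (hfreq j).const_mul _) hF
  · intro x j
    exact mul_nonneg (by split_ifs; exacts [hw j, le_rfl]) (hfr0 x j)
  · intro x j
    refine mul_le_mul_of_nonneg_right ?_ (hfr0 x j)
    split_ifs
    exacts [le_rfl, hw j]

lemma pmfOf_nonneg {Ω' : Type*} [MeasurableSpace Ω'] (ν : Measure Ω') (X : Ω' → ℕ) (k : ℕ) :
    0 ≤ pmfOf ν X k := ENNReal.toReal_nonneg

lemma aCM_zero_le {V : Type*} [Fintype V] (dp dm : V → ℕ) (α : Bool) (k : ℕ) :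
    0 ≤ aCM dp dm α k :=
  Finset.sum_nonneg fun v _ => by split_ifs <;> simp

lemma hasSum_pmf_one {Ω' : Type*} [MeasurableSpace Ω'] (ν : Measure Ω') [IsProbabilityMeasure ν]
    (X : Ω' → ℕ) (hX : Measurable X) : HasSum (fun i => pmfOf ν X i) 1 := by
  have := hasSum_pmf ν X hX (fun _ => 1) (integrable_const _)
  simpa using this

lemma phiCM_nonneg {V : Type*} [Fintype V] (dp dm : V → ℕ) (α β : Bool) (k l : ℕ)
    (x : V × V → ℕ) : 0 ≤ phiCM dp dm α β k l x := by
  unfold phiCM indCM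
  refine Finset.sum_nonneg fun e _ => ?_
  refine div_nonneg (mul_nonneg (by split_ifs <;> norm_num) (Nat.cast_nonneg _))
    (Finset.sum_nonneg fun _ _ => Nat.cast_nonneg _)

lemma inv_mCM_le {V : Type*} [Fintype V] (dp : V → ℕ) : |1 / mCM dp| ≤ 1 := by
  rw [abs_of_nonneg (div_nonneg zero_le_one (mCM_nonneg dp))]
  have : mCM dp = ((∑ v, dp v : ℕ) : ℝ) := by simp [mCM]
  rw [this]
  rcases Nat.eq_zero_or_pos (∑ v, dp v) with h | h
  · simp [h]
  · exact div_le_one_of_le₀ (by exact_mod_cast h) (Nat.cast_nonneg _)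


set_option maxHeartbeats 2000000 in
/-- Under the bi-degree regularity hypotheses, for the directed
configuration model built conditionally on the bi-degrees via a uniformly random stub
pairing: the first and second moments of `Φ_n^{α,β}(k,l)` converge to
`P(𝒟^α=k)·P(𝒟^β=l)` and its square, and consequently `Φ_n^{α,β}(k,l)` converges in
probability to `P(𝒟^α=k)·P(𝒟^β=l)`. -/
theorem cm_phi_convergence
    {Ω : Type*} [MeasurableSpace Ω] (μ : Measure Ω) [IsProbabilityMeasure μ]
    {Ω' : Type*} [MeasurableSpace Ω'] (ν : Measure Ω') [IsProbabilityMeasure ν]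
    (dpn dmn : (n : ℕ) → Ω → (Fin n → ℕ))
    (hdp : ∀ n, Measurable (dpn n)) (hdm : ∀ n, Measurable (dmn n))
    (htot : ∀ n ω, ∑ v, dpn n ω v = ∑ v, dmn n ω v)
    (xi gam : Ω' → ℕ) (hxi : Measurable xi) (hgam : Measurable gam)
    (hxiInt : Integrable (fun ω => (xi ω : ℝ)) ν)
    (hgamInt : Integrable (fun ω => (gam ω : ℝ)) ν)
    (hpos : 0 < ∫ ω, (xi ω : ℝ) ∂ν)
    (heq : ∫ ω, (xi ω : ℝ) ∂ν = ∫ ω, (gam ω : ℝ) ∂ν)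
    (hjoint : ∀ k l : ℕ, TendstoInMeasure μ
      (fun (n : ℕ) ω => (1 / (n : ℝ)) * ∑ v : Fin n,
        if dpn n ω v = k ∧ dmn n ω v = l then (1 : ℝ) else 0) atTop
      (fun _ => pmfOf ν xi k * pmfOf ν gam l))
    (havgp : TendstoInMeasure μ
      (fun (n : ℕ) ω => (1 / (n : ℝ)) * ∑ v : Fin n, (dpn n ω v : ℝ)) atTop
      (fun _ => ∫ ω, (xi ω : ℝ) ∂ν))
    (havgm : TendstoInMeasure μ
      (fun (n : ℕ) ω => (1 / (n : ℝ)) * ∑ v : Fin n, (dmn n ω v : ℝ)) atTop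
      (fun _ => ∫ ω, (gam ω : ℝ) ∂ν))
    (Ehn : (n : ℕ) → Ω → (Fin n × Fin n → ℕ))
    (hEh : ∀ n, Measurable (Ehn n))
    (hCM : ∀ n (g : (Fin n × Fin n → ℕ) → ℝ), (∃ C, ∀ x, |g x| ≤ C) →
      μ[(fun ω => g (Ehn n ω)) |
          MeasurableSpace.comap (fun ω => (dpn n ω, dmn n ω)) inferInstance] =ᵐ[μ]
        fun ω => ∫ σ, g (pairingMult (dpn n ω) (dmn n ω) σ)
          ∂ uniformPairing (dpn n ω) (dmn n ω))
    (α β : Bool) (k l : ℕ) :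
    Tendsto (fun n => ∫ ω, phiCM (dpn n ω) (dmn n ω) α β k l (Ehn n ω) ∂μ) atTop
      (nhds (srcLimit ν xi gam α k * tgtLimit ν xi gam β l)) ∧
    Tendsto (fun n => ∫ ω, (phiCM (dpn n ω) (dmn n ω) α β k l (Ehn n ω)) ^ 2 ∂μ) atTop
      (nhds ((srcLimit ν xi gam α k) ^ 2 * (tgtLimit ν xi gam β l) ^ 2)) ∧
    TendstoInMeasure μ (fun n ω => phiCM (dpn n ω) (dmn n ω) α β k l (Ehn n ω)) atTop
      (fun _ => srcLimit ν xi gam α k * tgtLimit ν xi gam β l) := by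
  
  have hposg : 0 < ∫ ω, (gam ω : ℝ) ∂ν := heq ▸ hpos
  have hgne := hposg.ne'
  have hxne := hpos.ne'
  have hpx := hasSum_pmf_one ν xi hxi
  have hpg := hasSum_pmf_one ν gam hgam
  have hmx := hasSum_pmf ν xi hxi (fun i => (i : ℝ)) hxiInt
  have hmg := hasSum_pmf ν gam hgam (fun i => (i : ℝ)) hgamInt
  have px0 := pmfOf_nonneg ν xi
  have pg0 := pmfOf_nonneg ν gam
  have hsx : HasSum (fun i => if i = k then (i : ℝ) * pmfOf ν xi i else 0)
      ((k : ℝ) * pmfOf ν xi k) := by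
    refine (hasSum_ite_eq k ((k : ℝ) * pmfOf ν xi k)).congr_fun fun i => ?_
    split_ifs with h <;> simp [h]
  have hsx' : HasSum (fun i => if i = l then pmfOf ν xi i else 0) (pmfOf ν xi l) := by
    refine (hasSum_ite_eq l (pmfOf ν xi l)).congr_fun fun i => ?_
    split_ifs with h <;> simp [h]
  have hsg : HasSum (fun i => if i = l then (i : ℝ) * pmfOf ν gam i else 0)
      ((l : ℝ) * pmfOf ν gam l) := by
    refine (hasSum_ite_eq l ((l : ℝ) * pmfOf ν gam l)).congr_fun fun i => ?_
    split_ifs with h <;> simp [h]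
  have hsg' : HasSum (fun i => if i = k then pmfOf ν gam i else 0) (pmfOf ν gam k) := by
    refine (hasSum_ite_eq k (pmfOf ν gam k)).congr_fun fun i => ?_
    split_ifs with h <;> simp [h]
  have hfreq : ∀ j : ℕ × ℕ, Tendsto (fun x : ℕ × Ω => (1 / (x.1 : ℝ)) *
      ∑ v, if (dpn x.1 x.2 v, dmn x.1 x.2 v) = j then (1 : ℝ) else 0) (whp μ)
      (nhds (pmfOf ν xi j.1 * pmfOf ν gam j.2)) := by
    rintro ⟨i, j⟩
    have := (whp_iff μ _ _).1 (hjoint i j)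
    simpa only [Prod.mk.injEq] using this
  have hap := (whp_iff μ _ _).1 havgp
  have ham := (whp_iff μ _ _).1 havgm
  have hA : Tendsto (fun x : ℕ × Ω => (1 / (x.1 : ℝ)) * aCM (dpn x.1 x.2) (dmn x.1 x.2) α k)
      (whp μ) (nhds (srcLimit ν xi gam α k * ∫ ω, (xi ω : ℝ) ∂ν)) := by
    have := freq_limit (L := whp μ) (fun x : ℕ × Ω => x.1)
      (fun x v => (dpn x.1 x.2 v, dmn x.1 x.2 v))
      (fun j => pmfOf ν xi j.1 * pmfOf ν gam j.2) (fun j => (j.1 : ℝ))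
      (fun j => Nat.cast_nonneg _) hfreq (C := ∫ ω, (xi ω : ℝ) ∂ν)
      (by
        have := hasSum_prod_nonneg (fun i => mul_nonneg (Nat.cast_nonneg i) (px0 i)) pg0 hmx hpg
        simpa only [mul_one, mul_assoc] using this)
      hap (fun j => (if α then j.1 else j.2) = k)
      (Z := srcLimit ν xi gam α k * ∫ ω, (xi ω : ℝ) ∂ν)
      (by
        cases α
        · have := hasSum_prod_nonneg (fun i => mul_nonneg (Nat.cast_nonneg i) (px0 i))
            (fun i => by split_ifs; exacts [pg0 i, le_rfl]) hmx hsg'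
          rw [mul_comm] at this
          simp only [srcLimit, Bool.false_eq_true, if_false]
          refine this.congr_fun fun j => ?_
          split_ifs <;> ring
        · have := hasSum_prod_nonneg
            (fun i => by split_ifs; exacts [mul_nonneg (Nat.cast_nonneg i) (px0 i), le_rfl])
            pg0 hsx hpg
          simp only [srcLimit, if_true]
          rw [div_mul_cancel₀ _ hxne]
          rw [mul_one] at this
          refine this.congr_fun fun j => ?_
          split_ifs <;> ring)
    exact this
  have hB : Tendsto (fun x : ℕ × Ω => (1 / (x.1 : ℝ)) * bCM (dpn x.1 x.2) (dmn x.1 x.2) β l)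
      (whp μ) (nhds (tgtLimit ν xi gam β l * ∫ ω, (gam ω : ℝ) ∂ν)) := by
    have := freq_limit (L := whp μ) (fun x : ℕ × Ω => x.1)
      (fun x v => (dpn x.1 x.2 v, dmn x.1 x.2 v))
      (fun j => pmfOf ν xi j.1 * pmfOf ν gam j.2) (fun j => (j.2 : ℝ))
      (fun j => Nat.cast_nonneg _) hfreq (C := ∫ ω, (gam ω : ℝ) ∂ν)
      (by
        have := hasSum_prod_nonneg px0 (fun i => mul_nonneg (Nat.cast_nonneg i) (pg0 i)) hpx hmg
        simpa only [one_mul, mul_left_comm] using this)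
      ham (fun j => (if β then j.1 else j.2) = l)
      (Z := tgtLimit ν xi gam β l * ∫ ω, (gam ω : ℝ) ∂ν)
      (by
        cases β
        · have := hasSum_prod_nonneg px0
            (fun i => by split_ifs; exacts [mul_nonneg (Nat.cast_nonneg i) (pg0 i), le_rfl])
            hpx hsg
          simp only [tgtLimit, Bool.false_eq_true, if_false]
          rw [div_mul_cancel₀ _ hgne]
          rw [one_mul] at this
          refine this.congr_fun fun j => ?_
          split_ifs <;> ring
        · have := hasSum_prod_nonneg
            (fun i => by split_ifs; exacts [px0 i, le_rfl])
            (fun i => mul_nonneg (Nat.cast_nonneg i) (pg0 i)) hsx' hmg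
          simp only [tgtLimit, if_true]
          refine this.congr_fun fun j => ?_
          split_ifs <;> ring)
    exact this
  have hM : Tendsto (fun x : ℕ × Ω => (1 / (x.1 : ℝ)) * mCM (dpn x.1 x.2))
      (whp μ) (nhds (∫ ω, (xi ω : ℝ) ∂ν)) := hap
  have hn : ∀ᶠ x : ℕ × Ω in whp μ, (x.1 : ℝ) ≠ 0 := by
    filter_upwards [(whp_fst μ).eventually (eventually_ge_atTop 1)] with x hx
    exact_mod_cast (Nat.one_le_iff_ne_zero.1 hx)
  have hX : Tendsto (fun x : ℕ × Ω => aCM (dpn x.1 x.2) (dmn x.1 x.2) α k *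
      bCM (dpn x.1 x.2) (dmn x.1 x.2) β l / mCM (dpn x.1 x.2) ^ 2) (whp μ)
      (nhds (srcLimit ν xi gam α k * tgtLimit ν xi gam β l)) := by
    have h := (hA.mul hB).div (hM.pow 2) (pow_ne_zero 2 hxne)
    have e : srcLimit ν xi gam α k * (∫ ω, (xi ω : ℝ) ∂ν) *
        (tgtLimit ν xi gam β l * ∫ ω, (gam ω : ℝ) ∂ν) / (∫ ω, (xi ω : ℝ) ∂ν) ^ 2 =
        srcLimit ν xi gam α k * tgtLimit ν xi gam β l := by
      rw [← heq]; field_simp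
    rw [e] at h
    refine h.congr' ?_
    filter_upwards [hn] with x hx
    simp only [Pi.div_apply]
    by_cases hm : mCM (dpn x.1 x.2) = 0
    · simp [hm]
    · field_simp
  have hInv : TendstoInMeasure μ (fun n ω => 1 / mCM (dpn n ω)) atTop (fun _ => (0 : ℝ)) := by
    rw [whp_iff]
    have h0 : Tendsto (fun x : ℕ × Ω => 1 / (x.1 : ℝ)) (whp μ) (nhds 0) :=
      tendsto_one_div_atTop_nhds_zero_nat.comp (whp_fst μ)
    have h := h0.div hM hxne
    rw [zero_div] at h
    refine h.congr' ?_
    filter_upwards [hn] with x hx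
    simp only [Pi.div_apply]
    by_cases hm : mCM (dpn x.1 x.2) = 0
    · simp [hm]
    · field_simp
  have hdeg : ∀ n, Measurable (fun ω => (dpn n ω, dmn n ω)) := fun n => (hdp n).prodMk (hdm n)
  have hInvInt : Tendsto (fun n => ∫ ω, 1 / mCM (dpn n ω) ∂μ) atTop (nhds 0) := by
    refine tendsto_integral_bdd μ (fun n => ?_) (fun n => .of_forall fun ω => inv_mCM_le _) hInv
    exact (Measurable.of_discrete (f := fun d : Fin n → ℕ => 1 / mCM d)).comp (hdp n)
  -- measurability of `Φ`
  have hYm : ∀ n, Measurable (fun ω => phiCM (dpn n ω) (dmn n ω) α β k l (Ehn n ω)) := fun n =>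
    (Measurable.of_discrete (f := fun p : ((Fin n → ℕ) × (Fin n → ℕ)) × (Fin n × Fin n → ℕ) =>
      phiCM p.1.1 p.1.2 α β k l p.2)).comp ((hdeg n).prodMk (hEh n))
  -- `Φ ≤ 1` almost surely
  have hY1 : ∀ n, ∀ᵐ ω ∂μ, |phiCM (dpn n ω) (dmn n ω) α β k l (Ehn n ω)| ≤ 1 := by
    intro n
    have h := disint μ (fun ω => (dpn n ω, dmn n ω)) (hdeg n) (Ehn n) (hEh n)
      (fun d g => ∫ σ, g (pairingMult d.1 d.2 σ) ∂ uniformPairing d.1 d.2) (hCM n)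
      (fun d x => if phiCM d.1 d.2 α β k l x ≤ 1 then 0 else 1)
      (fun d x => by split_ifs <;> norm_num) (fun _ => 0) (fun _ => by norm_num)
      (fun ω => by simp [phi_pairing_le_one])
    rw [integral_zero] at h
    have h0 : ∀ ω, (0 : ℝ) ≤
        if phiCM (dpn n ω) (dmn n ω) α β k l (Ehn n ω) ≤ 1 then (0 : ℝ) else 1 := fun ω => by
      split_ifs <;> norm_num
    have hmeas : Measurable (fun ω =>
        if phiCM (dpn n ω) (dmn n ω) α β k l (Ehn n ω) ≤ 1 then (0 : ℝ) else 1) :=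
      Measurable.ite (measurableSet_le (hYm n) measurable_const) measurable_const measurable_const
    have hint : Integrable (fun ω =>
        if phiCM (dpn n ω) (dmn n ω) α β k l (Ehn n ω) ≤ 1 then (0 : ℝ) else 1) μ :=
      Integrable.of_bound hmeas.aestronglyMeasurable 1
        (.of_forall fun ω => by split_ifs <;> norm_num)
    have hz := (integral_eq_zero_iff_of_nonneg h0 hint).1 (le_antisymm h (integral_nonneg h0))
    filter_upwards [hz] with ω hω
    rw [abs_of_nonneg (phiCM_nonneg ..)]
    by_contra hcon
    simp [hcon] at hω
  -- concentration
  have hconc : TendstoInMeasure μ (fun n ω => min ((phiCM (dpn n ω) (dmn n ω) α β k l (Ehn n ω)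
      - aCM (dpn n ω) (dmn n ω) α k * bCM (dpn n ω) (dmn n ω) β l / mCM (dpn n ω) ^ 2) ^ 2) 1)
      atTop (fun _ => (0 : ℝ)) := by
    have hmin : ∀ y : ℝ, 0 ≤ min (y ^ 2) 1 := fun y => le_min (sq_nonneg _) zero_le_one
    have hminabs : ∀ y : ℝ, |min (y ^ 2) 1| ≤ 1 := fun y => by
      rw [abs_of_nonneg (hmin y)]; exact min_le_right _ _
    have hm : ∀ n, Measurable (fun ω => min ((phiCM (dpn n ω) (dmn n ω) α β k l (Ehn n ω)
      - aCM (dpn n ω) (dmn n ω) α k * bCM (dpn n ω) (dmn n ω) β l / mCM (dpn n ω) ^ 2) ^ 2) 1) :=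
      fun n => (Measurable.of_discrete
        (f := fun p : ((Fin n → ℕ) × (Fin n → ℕ)) × (Fin n × Fin n → ℕ) =>
        min ((phiCM p.1.1 p.1.2 α β k l p.2
          - aCM p.1.1 p.1.2 α k * bCM p.1.1 p.1.2 β l / mCM p.1.1 ^ 2) ^ 2) 1)).comp
          ((hdeg n).prodMk (hEh n))
    have hle : ∀ n, ∫ ω, min ((phiCM (dpn n ω) (dmn n ω) α β k l (Ehn n ω)
      - aCM (dpn n ω) (dmn n ω) α k * bCM (dpn n ω) (dmn n ω) β l / mCM (dpn n ω) ^ 2) ^ 2) 1 ∂μ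
        ≤ ∫ ω, 1 / mCM (dpn n ω) ∂μ := fun n =>
      disint μ (fun ω => (dpn n ω, dmn n ω)) (hdeg n) (Ehn n) (hEh n)
        (fun d g => ∫ σ, g (pairingMult d.1 d.2 σ) ∂ uniformPairing d.1 d.2) (hCM n)
        (fun d x => min ((phiCM d.1 d.2 α β k l x
          - aCM d.1 d.2 α k * bCM d.1 d.2 β l / mCM d.1 ^ 2) ^ 2) 1)
        (fun d x => hminabs _) (fun d => 1 / mCM d.1) (fun d => inv_mCM_le _)
        (fun ω => pairing_var _ _ (htot n ω) α β k l)
    have hlim := tendsto_of_tendsto_of_tendsto_of_le_of_le tendsto_const_nhds hInvInt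
      (fun n => integral_nonneg fun ω => hmin _) hle
    rw [tendstoInMeasure_iff_measureReal_norm]
    intro ε hε
    have hlim' := hlim.const_mul ε⁻¹
    rw [mul_zero] at hlim'
    refine tendsto_of_tendsto_of_tendsto_of_le_of_le tendsto_const_nhds hlim'
      (fun n => measureReal_nonneg) (fun n => ?_)
    have hmk := mul_meas_ge_le_integral_of_nonneg (μ := μ)
      (.of_forall fun ω => hmin (phiCM (dpn n ω) (dmn n ω) α β k l (Ehn n ω)
      - aCM (dpn n ω) (dmn n ω) α k * bCM (dpn n ω) (dmn n ω) β l / mCM (dpn n ω) ^ 2))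
      (Integrable.of_bound (hm n).aestronglyMeasurable 1 (.of_forall fun ω => hminabs _)) ε
    rw [le_inv_mul_iff₀ hε]
    simpa only [sub_zero, Real.norm_of_nonneg (hmin _)] using hmk
  have hYL : Tendsto (fun x : ℕ × Ω =>
      phiCM (dpn x.1 x.2) (dmn x.1 x.2) α β k l (Ehn x.1 x.2)) (whp μ)
      (nhds (srcLimit ν xi gam α k * tgtLimit ν xi gam β l)) := by
    have hc := (whp_iff μ _ _).1 hconc
    have hd : Tendsto (fun x : ℕ × Ω =>
        phiCM (dpn x.1 x.2) (dmn x.1 x.2) α β k l (Ehn x.1 x.2) -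
        aCM (dpn x.1 x.2) (dmn x.1 x.2) α k *
          bCM (dpn x.1 x.2) (dmn x.1 x.2) β l / mCM (dpn x.1 x.2) ^ 2) (whp μ) (nhds 0) := by
      rw [Metric.tendsto_nhds]
      intro ε hε
      have hpos' : (0 : ℝ) < min (ε ^ 2) 1 := lt_min (by positivity) one_pos
      filter_upwards [hc.eventually (gt_mem_nhds hpos')] with x hx
      rw [Real.dist_eq, sub_zero]
      have h2 := hx.trans_le (min_le_right _ _)
      rw [min_lt_iff] at h2
      have h3 := h2.resolve_right (lt_irrefl _)
      rw [min_eq_left h3.le] at hx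
      exact abs_lt_of_sq_lt_sq (hx.trans_le (min_le_left _ _)) hε.le
    have := hd.add hX
    simpa using this
  have hYM := (whp_iff μ (fun n ω => phiCM (dpn n ω) (dmn n ω) α β k l (Ehn n ω)) _).2 hYL
  refine ⟨tendsto_integral_bdd μ hYm hY1 hYM, ?_, hYM⟩
  rw [← mul_pow]
  refine tendsto_integral_bdd μ (fun n => (hYm n).pow_const 2) (fun n => ?_)
    ((whp_iff μ _ _).2 (hYL.pow 2))
  filter_upwards [hY1 n] with ω hω
  rw [abs_pow]
  exact pow_le_one₀ (abs_nonneg _) hω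
end

section
/- Let X, Y be integer-valued random variables on a common probability space, and let U, W be independent uniform-[0,1) random variables, independent of (X,Y). Let X̃=X+U and Ỹ=Y+W be the continuizations, with cdfs F_{X̃}, F_{Ỹ} and joint cdf H_{X̃,Ỹ}. Then (i) E[F_{X̃}(X̃)·F_{Ỹ}(Ỹ)] = (1/4)·E[𝓕_X(X)·𝓕_Y(Y)], and (ii) E[H_{X̃,Ỹ}(X̃,Ỹ)] = (1/4)·E[𝓗_{X,Y}(X,Y)]. Consequently, Spearman's rho and Kendall's tau of the integer-valued pair (X,Y) coincide with the classical continuous Spearman's rho 12·E[F_{X̃}(X̃)F_{Ỹ}(Ỹ)]−3 and Kendall's tau 4·E[H_{X̃,Ỹ}(X̃,Ỹ)]−1 of (X̃,Ỹ). -/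
open MeasureTheory ProbabilityTheory

/-- `F_X(k) = P(X ≤ k)`. -/
noncomputable def intCdf {Ω : Type*} [MeasurableSpace Ω] (μ : Measure Ω)
    (X : Ω → ℤ) (k : ℤ) : ℝ :=
  (μ {ω | X ω ≤ k}).toReal

/-- `𝓕_X(k) = F_X(k) + F_X(k−1)`. -/
noncomputable def scriptF {Ω : Type*} [MeasurableSpace Ω] (μ : Measure Ω)
    (X : Ω → ℤ) (k : ℤ) : ℝ :=
  intCdf μ X k + intCdf μ X (k - 1)

/-- Joint cdf `H_{X,Y}(k,l) = P(X ≤ k, Y ≤ l)`. -/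
noncomputable def intJointCdf {Ω : Type*} [MeasurableSpace Ω] (μ : Measure Ω)
    (X Y : Ω → ℤ) (k l : ℤ) : ℝ :=
  (μ {ω | X ω ≤ k ∧ Y ω ≤ l}).toReal

/-- `𝓗_{X,Y}(k,l)`. -/
noncomputable def scriptH {Ω : Type*} [MeasurableSpace Ω] (μ : Measure Ω)
    (X Y : Ω → ℤ) (k l : ℤ) : ℝ :=
  intJointCdf μ X Y k l + intJointCdf μ X Y (k - 1) l +
    intJointCdf μ X Y k (l - 1) + intJointCdf μ X Y (k - 1) (l - 1)

/-- Spearman's rho `ρ(X,Y) = 3·E[𝓕_X(X)𝓕_Y(Y)] − 3`. -/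
noncomputable def spearman {Ω : Type*} [MeasurableSpace Ω] (μ : Measure Ω)
    (X Y : Ω → ℤ) : ℝ :=
  3 * ∫ ω, scriptF μ X (X ω) * scriptF μ Y (Y ω) ∂μ - 3

/-- Kendall's tau `τ(X,Y) = E[𝓗_{X,Y}(X,Y)] − 1`. -/
noncomputable def kendall {Ω : Type*} [MeasurableSpace Ω] (μ : Measure Ω)
    (X Y : Ω → ℤ) : ℝ :=
  ∫ ω, scriptH μ X Y (X ω) (Y ω) ∂μ - 1

/-- cdf of a real random variable. -/
noncomputable def contCdf {Ω : Type*} [MeasurableSpace Ω] (μ : Measure Ω)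
    (T : Ω → ℝ) (x : ℝ) : ℝ :=
  (μ {ω | T ω ≤ x}).toReal

/-- Joint cdf of a pair of real random variables. -/
noncomputable def contJointCdf {Ω : Type*} [MeasurableSpace Ω] (μ : Measure Ω)
    (T S : Ω → ℝ) (x y : ℝ) : ℝ :=
  (μ {ω | T ω ≤ x ∧ S ω ≤ y}).toReal

section helpers

variable {Ω : Type*} [MeasurableSpace Ω] {μ : Measure Ω}

lemma indep_real {α β : Type*} [MeasurableSpace α] [MeasurableSpace β] {f : Ω → α} {g : Ω → β}
    (h : IndepFun f g μ) (A : Set α) (B : Set β) (hA : MeasurableSet A) (hB : MeasurableSet B) :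
    μ.real (f ⁻¹' A ∩ g ⁻¹' B) = μ.real (f ⁻¹' A) * μ.real (g ⁻¹' B) := by
  simp only [measureReal_def, h.measure_inter_preimage_eq_mul A B hA hB, ENNReal.toReal_mul]

lemma integral_add4 {f1 f2 f3 f4 : Ω → ℝ} (h1 : Integrable f1 μ) (h2 : Integrable f2 μ)
    (h3 : Integrable f3 μ) (h4 : Integrable f4 μ) :
    ∫ ω, (f1 ω + f2 ω + f3 ω + f4 ω) ∂μ =
      ∫ ω, f1 ω ∂μ + ∫ ω, f2 ω ∂μ + ∫ ω, f3 ω ∂μ + ∫ ω, f4 ω ∂μ := by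
  have h12 : Integrable (fun ω => f1 ω + f2 ω) μ := h1.add h2
  have h123 : Integrable (fun ω => f1 ω + f2 ω + f3 ω) μ := h12.add h3
  rw [integral_add h123 h4, integral_add h12 h3, integral_add h1 h2]

lemma unif_ae {U : Ω → ℝ} (hU : Measurable U)
    (h : Measure.map U μ = volume.restrict (Set.Ico (0 : ℝ) 1)) :
    ∀ᵐ ω ∂μ, U ω ∈ Set.Ico (0 : ℝ) 1 := by
  apply ae_of_ae_map hU.aemeasurable
  rw [h]
  exact ae_restrict_mem measurableSet_Ico

lemma unif_integrable {U : Ω → ℝ} (hU : Measurable U)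
    (h : Measure.map U μ = volume.restrict (Set.Ico (0 : ℝ) 1)) : Integrable U μ := by
  have : Integrable (fun x : ℝ => x) (Measure.map U μ) := by
    rw [h]
    exact (continuous_id.integrableOn_Icc (a := (0 : ℝ)) (b := 1)).mono_set Set.Ico_subset_Icc_self
  exact this.comp_measurable hU

lemma unif_integral {U : Ω → ℝ} (hU : Measurable U)
    (h : Measure.map U μ = volume.restrict (Set.Ico (0 : ℝ) 1)) : ∫ ω, U ω ∂μ = 1 / 2 := by
  have h1 : ∫ x, x ∂(Measure.map U μ) = ∫ ω, U ω ∂μ :=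
    integral_map hU.aemeasurable (by fun_prop)
  rw [← h1, h, integral_Ico_eq_integral_Ioo, ← integral_Ioc_eq_integral_Ioo,
    ← intervalIntegral.integral_of_le zero_le_one, integral_id]
  norm_num

lemma unif_le [IsProbabilityMeasure μ] {U : Ω → ℝ} (hU : Measurable U)
    (h : Measure.map U μ = volume.restrict (Set.Ico (0 : ℝ) 1)) {u : ℝ}
    (hu : u ∈ Set.Ico (0 : ℝ) 1) : μ.real (U ⁻¹' Set.Iic u) = u := by
  rw [← map_measureReal_apply hU measurableSet_Iic, h, measureReal_restrict_apply measurableSet_Iic]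
  have : Set.Iic u ∩ Set.Ico (0 : ℝ) 1 = Set.Icc 0 u := by
    ext x; simp only [Set.mem_inter_iff, Set.mem_Iic, Set.mem_Ico, Set.mem_Icc]
    constructor
    · rintro ⟨a, b, c⟩; exact ⟨b, a⟩
    · rintro ⟨a, b⟩; exact ⟨b, a, b.trans_lt hu.2⟩
  rw [this, Real.volume_real_Icc_of_le hu.1, sub_zero]

lemma unif_gt [IsProbabilityMeasure μ] {U : Ω → ℝ} (hU : Measurable U)
    (h : Measure.map U μ = volume.restrict (Set.Ico (0 : ℝ) 1)) {u : ℝ}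
    (hu : u ∈ Set.Ico (0 : ℝ) 1) : μ.real (U ⁻¹' Set.Ioi u) = 1 - u := by
  have := probReal_compl_eq_one_sub (μ := μ) (hU (measurableSet_Iic (a := u)))
  rw [unif_le hU h hu] at this
  rw [← this, ← Set.preimage_compl, Set.compl_Iic]

lemma cont_add_le_iff {x k : ℤ} {v u : ℝ} (hv : v ∈ Set.Ico (0 : ℝ) 1) (hu : u ∈ Set.Ico (0 : ℝ) 1) :
    (x : ℝ) + v ≤ k + u ↔ (x ≤ k ∧ v ≤ u) ∨ (x ≤ k - 1 ∧ u < v) := by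
  obtain ⟨hv0, hv1⟩ := hv
  obtain ⟨hu0, hu1⟩ := hu
  constructor
  · intro h
    have h1 : x ≤ k := by
      by_contra! hc
      have : (k : ℝ) + 1 ≤ x := by exact_mod_cast hc
      linarith
    rcases le_or_gt v u with h2 | h2
    · exact Or.inl ⟨h1, h2⟩
    · refine Or.inr ⟨?_, h2⟩
      have : (x : ℝ) < k := by linarith
      have : x < k := by exact_mod_cast this
      omega
  · rintro (⟨h1, h2⟩ | ⟨h1, h2⟩)
    · have : (x : ℝ) ≤ k := by exact_mod_cast h1
      linarith
    · have : (x : ℝ) ≤ k - 1 := by exact_mod_cast h1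
      linarith

/-- cdf of a continuization. -/
lemma contCdf_eq [IsProbabilityMeasure μ] {X : Ω → ℤ} {U : Ω → ℝ} (hX : Measurable X)
    (hU : Measurable U) (hXU : IndepFun X U μ)
    (h : Measure.map U μ = volume.restrict (Set.Ico (0 : ℝ) 1)) (k : ℤ) {u : ℝ}
    (hu : u ∈ Set.Ico (0 : ℝ) 1) :
    contCdf μ (fun ω => (X ω : ℝ) + U ω) (k + u) =
      u * intCdf μ X k + (1 - u) * intCdf μ X (k - 1) := by
  have e : μ.real {ω | (X ω : ℝ) + U ω ≤ k + u} =
      μ.real ((X ⁻¹' Set.Iic k ∩ U ⁻¹' Set.Iic u) ∪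
        (X ⁻¹' Set.Iic (k - 1) ∩ U ⁻¹' Set.Ioi u)) := by
    apply measureReal_congr
    filter_upwards [unif_ae hU h] with ω hω
    exact propext (cont_add_le_iff hω hu)
  have m (k : ℤ) : MeasurableSet (X ⁻¹' Set.Iic k) := hX measurableSet_Iic
  have e1 := indep_real hXU (Set.Iic k) (Set.Iic u)
    measurableSet_Iic measurableSet_Iic
  have e2 := indep_real hXU (Set.Iic (k - 1)) (Set.Ioi u)
    measurableSet_Iic measurableSet_Ioi
  rw [measureReal_union ?_ ((m _).inter (hU measurableSet_Ioi)), e1, e2, unif_le hU h hu,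
    unif_gt hU h hu] at e
  · change μ.real _ = u * μ.real (X ⁻¹' Set.Iic k) + (1 - u) * μ.real (X ⁻¹' Set.Iic (k - 1))
    rw [e]; ring
  · rw [Set.disjoint_left]
    rintro ω ⟨_, h1⟩ ⟨_, h2⟩
    have h3 : U ω ≤ u := h1
    have h4 : u < U ω := h2
    exact absurd h3 (not_le.2 h4)

/-- joint cdf of a continuization. -/
lemma contJointCdf_eq [IsProbabilityMeasure μ] {X Y : Ω → ℤ} {U W : Ω → ℝ} (hX : Measurable X)
    (hY : Measurable Y) (hU : Measurable U) (hW : Measurable W) (hUW : IndepFun U W μ)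
    (hXYUW : IndepFun (fun ω => (X ω, Y ω)) (fun ω => (U ω, W ω)) μ)
    (h : Measure.map U μ = volume.restrict (Set.Ico (0 : ℝ) 1))
    (h' : Measure.map W μ = volume.restrict (Set.Ico (0 : ℝ) 1)) (k l : ℤ) {u w : ℝ}
    (hu : u ∈ Set.Ico (0 : ℝ) 1) (hw : w ∈ Set.Ico (0 : ℝ) 1) :
    contJointCdf μ (fun ω => (X ω : ℝ) + U ω) (fun ω => (Y ω : ℝ) + W ω) (k + u) (l + w) =
      u * w * intJointCdf μ X Y k l + (1 - u) * w * intJointCdf μ X Y (k - 1) l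
      + u * (1 - w) * intJointCdf μ X Y k (l - 1)
      + (1 - u) * (1 - w) * intJointCdf μ X Y (k - 1) (l - 1) := by
  let T (k l : ℤ) (A B : Set ℝ) : Set Ω :=
    (fun ω => (X ω, Y ω)) ⁻¹' (Set.Iic k ×ˢ Set.Iic l) ∩ (fun ω => (U ω, W ω)) ⁻¹' (A ×ˢ B)
  have hT (k l : ℤ) (A B : Set ℝ) (hA : MeasurableSet A) (hB : MeasurableSet B) :
      MeasurableSet (T k l A B) :=
    ((hX.prodMk hY) (measurableSet_Iic.prod measurableSet_Iic)).inter
      ((hU.prodMk hW) (hA.prod hB))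
  have vT (k l : ℤ) (A B : Set ℝ) (hA : MeasurableSet A) (hB : MeasurableSet B) :
      μ.real (T k l A B) =
        intJointCdf μ X Y k l * (μ.real (U ⁻¹' A) * μ.real (W ⁻¹' B)) := by
    have e1 := indep_real hXYUW (Set.Iic k ×ˢ Set.Iic l) (A ×ˢ B)
      (measurableSet_Iic.prod measurableSet_Iic) (hA.prod hB)
    have e2 := indep_real hUW A B hA hB
    rw [← e2]
    exact e1
  have e : μ.real {ω | (X ω : ℝ) + U ω ≤ k + u ∧ (Y ω : ℝ) + W ω ≤ l + w} =
      μ.real (((T k l (Set.Iic u) (Set.Iic w) ∪ T (k - 1) l (Set.Ioi u) (Set.Iic w)) ∪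
        T k (l - 1) (Set.Iic u) (Set.Ioi w)) ∪ T (k - 1) (l - 1) (Set.Ioi u) (Set.Ioi w)) := by
    apply measureReal_congr
    filter_upwards [unif_ae hU h, unif_ae hW h'] with ω hω hω'
    apply propext
    change ((X ω : ℝ) + U ω ≤ k + u ∧ (Y ω : ℝ) + W ω ≤ l + w) ↔ 
      ((((X ω ≤ k ∧ Y ω ≤ l) ∧ (U ω ≤ u ∧ W ω ≤ w)) ∨
      ((X ω ≤ k - 1 ∧ Y ω ≤ l) ∧ (u < U ω ∧ W ω ≤ w))) ∨
      ((X ω ≤ k ∧ Y ω ≤ l - 1) ∧ (U ω ≤ u ∧ w < W ω))) ∨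
      ((X ω ≤ k - 1 ∧ Y ω ≤ l - 1) ∧ (u < U ω ∧ w < W ω))
    rw [cont_add_le_iff hω hu, cont_add_le_iff hω' hw]
    tauto
  have mI := measurableSet_Iic (a := u)
  have mI' := measurableSet_Iic (a := w)
  have mJ := measurableSet_Ioi (a := u)
  have mJ' := measurableSet_Ioi (a := w)
  rw [measureReal_union ?_ (hT _ _ _ _ mJ mJ'), measureReal_union ?_ (hT _ _ _ _ mI mJ'),
    measureReal_union ?_ (hT _ _ _ _ mJ mI'), vT _ _ _ _ mI mI', vT _ _ _ _ mI mJ',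
    vT _ _ _ _ mJ mI', vT _ _ _ _ mJ mJ', unif_le hU h hu, unif_le hW h' hw,
    unif_gt hU h hu, unif_gt hW h' hw] at e
  · change μ.real _ = _
    rw [e]; ring
  all_goals
    rw [Set.disjoint_left]
    intro ω
    simp only [T, Set.mem_union, Set.mem_inter_iff, Set.mem_preimage, Set.mem_prod, Set.mem_Iic,
      Set.mem_Ioi, ← not_le]
    tauto

lemma term_integral [IsProbabilityMeasure μ] {X Y : Ω → ℤ} {U W : Ω → ℝ} (hX : Measurable X)
    (hY : Measurable Y) (hU : Measurable U) (hW : Measurable W) (hUW : IndepFun U W μ)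
    (hXYUW : IndepFun (fun ω => (X ω, Y ω)) (fun ω => (U ω, W ω)) μ)
    {a b : ℝ → ℝ} (ha : Measurable a) (hb : Measurable b)
    (ia : Integrable (fun ω => a (U ω)) μ) (ib : Integrable (fun ω => b (W ω)) μ)
    (va : ∫ ω, a (U ω) ∂μ = 1 / 2) (vb : ∫ ω, b (W ω) ∂μ = 1 / 2)
    {g : ℤ → ℤ → ℝ} (ig : Integrable (fun ω => g (X ω) (Y ω)) μ) :
    Integrable (fun ω => a (U ω) * b (W ω) * g (X ω) (Y ω)) μ ∧
      ∫ ω, a (U ω) * b (W ω) * g (X ω) (Y ω) ∂μ = 1 / 4 * ∫ ω, g (X ω) (Y ω) ∂μ := by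
  have i1 : IndepFun (fun ω => a (U ω)) (fun ω => b (W ω)) μ := hUW.comp ha hb
  have i2 : IndepFun (fun ω => a (U ω) * b (W ω)) (fun ω => g (X ω) (Y ω)) μ :=
    hXYUW.symm.comp (φ := fun p : ℝ × ℝ => a p.1 * b p.2) (ψ := fun p : ℤ × ℤ => g p.1 p.2)
      (by fun_prop) (measurable_of_countable _)
  have iab : Integrable (fun ω => a (U ω) * b (W ω)) μ := i1.integrable_mul ia ib
  refine ⟨i2.integrable_mul iab ig, ?_⟩
  rw [i2.integral_fun_mul_eq_mul_integral iab.1 ig.1,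
    i1.integral_fun_mul_eq_mul_integral ia.1 ib.1, va, vb]
  norm_num

lemma comb_integral [IsProbabilityMeasure μ] {X Y : Ω → ℤ} {U W : Ω → ℝ} (hX : Measurable X)
    (hY : Measurable Y) (hU : Measurable U) (hW : Measurable W) (hUW : IndepFun U W μ)
    (hXYUW : IndepFun (fun ω => (X ω, Y ω)) (fun ω => (U ω, W ω)) μ)
    (h : Measure.map U μ = volume.restrict (Set.Ico (0 : ℝ) 1))
    (h' : Measure.map W μ = volume.restrict (Set.Ico (0 : ℝ) 1))
    (g1 g2 g3 g4 : ℤ → ℤ → ℝ) (b1 : ∀ k l, |g1 k l| ≤ 1) (b2 : ∀ k l, |g2 k l| ≤ 1)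
    (b3 : ∀ k l, |g3 k l| ≤ 1) (b4 : ∀ k l, |g4 k l| ≤ 1) :
    ∫ ω, (U ω * W ω * g1 (X ω) (Y ω) + (1 - U ω) * W ω * g2 (X ω) (Y ω)
      + U ω * (1 - W ω) * g3 (X ω) (Y ω) + (1 - U ω) * (1 - W ω) * g4 (X ω) (Y ω)) ∂μ =
    1 / 4 * ∫ ω, (g1 (X ω) (Y ω) + g2 (X ω) (Y ω) + g3 (X ω) (Y ω) + g4 (X ω) (Y ω)) ∂μ := by
  have ig (g : ℤ → ℤ → ℝ) (b : ∀ k l, |g k l| ≤ 1) : Integrable (fun ω => g (X ω) (Y ω)) μ := by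
    refine Integrable.of_bound (C := 1) ?_ (ae_of_all _ fun ω => b _ _)
    have : Measurable (fun p : ℤ × ℤ => g p.1 p.2) := measurable_of_countable _
    exact (this.comp (hX.prodMk hY)).aestronglyMeasurable
  have iU := unif_integrable hU h
  have iW := unif_integrable hW h'
  have vU := unif_integral hU h
  have vW := unif_integral hW h'
  have iU' : Integrable (fun ω => 1 - U ω) μ := (integrable_const 1).sub iU
  have iW' : Integrable (fun ω => 1 - W ω) μ := (integrable_const 1).sub iW
  have vU' : ∫ ω, (1 - U ω) ∂μ = 1 / 2 := by
    rw [integral_sub (integrable_const 1) iU, vU]; simp; norm_num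
  have vW' : ∫ ω, (1 - W ω) ∂μ = 1 / 2 := by
    rw [integral_sub (integrable_const 1) iW, vW]; simp; norm_num
  have m1 : Measurable (fun x : ℝ => x) := measurable_id
  have m2 : Measurable (fun x : ℝ => 1 - x) := by fun_prop
  obtain ⟨p1, q1⟩ := term_integral hX hY hU hW hUW hXYUW m1 m1 iU iW vU vW (ig g1 b1)
  obtain ⟨p2, q2⟩ := term_integral hX hY hU hW hUW hXYUW m2 m1 iU' iW vU' vW (ig g2 b2)
  obtain ⟨p3, q3⟩ := term_integral hX hY hU hW hUW hXYUW m1 m2 iU iW' vU vW' (ig g3 b3)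
  obtain ⟨p4, q4⟩ := term_integral hX hY hU hW hUW hXYUW m2 m2 iU' iW' vU' vW' (ig g4 b4)
  rw [integral_add4 p1 p2 p3 p4, integral_add4 (ig g1 b1) (ig g2 b2) (ig g3 b3) (ig g4 b4),
    q1, q2, q3, q4]
  ring

lemma abs_intCdf_le [IsProbabilityMeasure μ] (X : Ω → ℤ) (k : ℤ) : |intCdf μ X k| ≤ 1 := by
  change |μ.real _| ≤ 1
  rw [abs_of_nonneg measureReal_nonneg]
  exact measureReal_le_one

lemma abs_intJointCdf_le [IsProbabilityMeasure μ] (X Y : Ω → ℤ) (k l : ℤ) :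
    |intJointCdf μ X Y k l| ≤ 1 := by
  change |μ.real _| ≤ 1
  rw [abs_of_nonneg measureReal_nonneg]
  exact measureReal_le_one

end helpers

/-- For the continuizations `X̃ = X + U`, `Ỹ = Y + W` of an
integer-valued pair `(X,Y)` (with `U, W` independent uniform-`[0,1)` variables independent
of `(X,Y)`): (i) `E[F_{X̃}(X̃)F_{Ỹ}(Ỹ)] = (1/4)E[𝓕_X(X)𝓕_Y(Y)]`,
(ii) `E[H_{X̃,Ỹ}(X̃,Ỹ)] = (1/4)E[𝓗_{X,Y}(X,Y)]`; consequently the discrete Spearman's rho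
and Kendall's tau coincide with the classical continuous ones of `(X̃,Ỹ)`. -/
theorem continuization_preserves_rank_correlations {Ω : Type*} [MeasurableSpace Ω]
    (μ : Measure Ω) [IsProbabilityMeasure μ]
    (X Y : Ω → ℤ) (U W : Ω → ℝ)
    (hX : Measurable X) (hY : Measurable Y) (hU : Measurable U) (hW : Measurable W)
    (hUW : IndepFun U W μ)
    (hXYUW : IndepFun (fun ω => (X ω, Y ω)) (fun ω => (U ω, W ω)) μ)
    (hUunif : Measure.map U μ = volume.restrict (Set.Ico (0 : ℝ) 1))
    (hWunif : Measure.map W μ = volume.restrict (Set.Ico (0 : ℝ) 1)) :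
    (∫ ω, contCdf μ (fun ω' => (X ω' : ℝ) + U ω') ((X ω : ℝ) + U ω) *
        contCdf μ (fun ω' => (Y ω' : ℝ) + W ω') ((Y ω : ℝ) + W ω) ∂μ =
      (1 / 4) * ∫ ω, scriptF μ X (X ω) * scriptF μ Y (Y ω) ∂μ) ∧
    (∫ ω, contJointCdf μ (fun ω' => (X ω' : ℝ) + U ω') (fun ω' => (Y ω' : ℝ) + W ω')
        ((X ω : ℝ) + U ω) ((Y ω : ℝ) + W ω) ∂μ =
      (1 / 4) * ∫ ω, scriptH μ X Y (X ω) (Y ω) ∂μ) ∧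
    (12 * ∫ ω, contCdf μ (fun ω' => (X ω' : ℝ) + U ω') ((X ω : ℝ) + U ω) *
        contCdf μ (fun ω' => (Y ω' : ℝ) + W ω') ((Y ω : ℝ) + W ω) ∂μ - 3 =
      spearman μ X Y) ∧
    (4 * ∫ ω, contJointCdf μ (fun ω' => (X ω' : ℝ) + U ω') (fun ω' => (Y ω' : ℝ) + W ω')
        ((X ω : ℝ) + U ω) ((Y ω : ℝ) + W ω) ∂μ - 1 =
      kendall μ X Y) := by
  have hXU : IndepFun X U μ := hXYUW.comp measurable_fst measurable_fst
  have hYW : IndepFun Y W μ := hXYUW.comp measurable_snd measurable_snd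
  have B (k l : ℤ) : |intCdf μ X k * intCdf μ Y l| ≤ 1 := by
    rw [abs_mul]
    exact mul_le_one₀ (abs_intCdf_le X k) (abs_nonneg _) (abs_intCdf_le Y l)
  have H1 : ∫ ω, contCdf μ (fun ω' => (X ω' : ℝ) + U ω') ((X ω : ℝ) + U ω) *
        contCdf μ (fun ω' => (Y ω' : ℝ) + W ω') ((Y ω : ℝ) + W ω) ∂μ =
      (1 / 4) * ∫ ω, scriptF μ X (X ω) * scriptF μ Y (Y ω) ∂μ := by
    have key := comb_integral hX hY hU hW hUW hXYUW hUunif hWunif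
      (fun k l => intCdf μ X k * intCdf μ Y l) (fun k l => intCdf μ X (k - 1) * intCdf μ Y l)
      (fun k l => intCdf μ X k * intCdf μ Y (l - 1))
      (fun k l => intCdf μ X (k - 1) * intCdf μ Y (l - 1))
      (fun k l => B _ _) (fun k l => B _ _) (fun k l => B _ _) (fun k l => B _ _)
    refine Eq.trans (integral_congr_ae ?_) (key.trans ?_)
    · filter_upwards [unif_ae hU hUunif, unif_ae hW hWunif] with ω hu hw
      rw [contCdf_eq hX hU hXU hUunif _ hu, contCdf_eq hY hW hYW hWunif _ hw]
      ring
    · congr 2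
      funext ω
      simp only [scriptF]
      ring
  have H2 : ∫ ω, contJointCdf μ (fun ω' => (X ω' : ℝ) + U ω') (fun ω' => (Y ω' : ℝ) + W ω')
        ((X ω : ℝ) + U ω) ((Y ω : ℝ) + W ω) ∂μ =
      (1 / 4) * ∫ ω, scriptH μ X Y (X ω) (Y ω) ∂μ := by
    have key := comb_integral hX hY hU hW hUW hXYUW hUunif hWunif
      (fun k l => intJointCdf μ X Y k l) (fun k l => intJointCdf μ X Y (k - 1) l)
      (fun k l => intJointCdf μ X Y k (l - 1))
      (fun k l => intJointCdf μ X Y (k - 1) (l - 1))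
      (fun k l => abs_intJointCdf_le X Y _ _) (fun k l => abs_intJointCdf_le X Y _ _)
      (fun k l => abs_intJointCdf_le X Y _ _) (fun k l => abs_intJointCdf_le X Y _ _)
    refine Eq.trans (integral_congr_ae ?_) key
    filter_upwards [unif_ae hU hUunif, unif_ae hW hWunif] with ω hu hw
    rw [contJointCdf_eq hX hY hU hW hUW hXYUW hUunif hWunif _ _ hu hw]
  refine ⟨H1, H2, ?_, ?_⟩
  · rw [H1, spearman]; ring
  · rw [H2, kendall]; ring
end
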